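/- arXiv:1112.4954 — 3 statements merged into one kernel-verified Lean document; each statement's English description precedes it below -/
import Mathlib

section
/- The algebra Br(B_n) is generated as a ℤ[δ,δ⁻¹]-module by a set of at most f(n) = 2^{n+1}·(2n−1)!! − 2^n·n! + (2n+1)!! − (n+1)! elements; i.e., there is a spanning set of Br(B_n) over ℤ[δ,δ⁻¹] of cardinality at most f(n). -/
/-- The ground ring `ℤ[δ, δ⁻¹]` of Laurent polynomials over `ℤ`. -/
abbrev Lp : Type := LaurentPolynomial ℤ

/-- The parameter `δ`. -/
noncomputable def δpar : Lp := LaurentPolynomial.T 1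

/-- Generators of the Brauer algebra of type `B_n`: `r i` and `e i` for `0 ≤ i ≤ n-1`. -/
inductive BGen (n : ℕ) : Type
  | r (i : Fin n) : BGen n
  | e (i : Fin n) : BGen n

/-- The generator `r i` viewed in the free algebra. -/
noncomputable def fr {n : ℕ} (i : Fin n) : FreeAlgebra Lp (BGen n) :=
  FreeAlgebra.ι Lp (BGen.r i)

/-- The generator `e i` viewed in the free algebra. -/
noncomputable def fe {n : ℕ} (i : Fin n) : FreeAlgebra Lp (BGen n) :=
  FreeAlgebra.ι Lp (BGen.e i)

/-- The defining relations of the Brauer algebra of type `B_n`. -/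
inductive BrauerBRel (n : ℕ) : FreeAlgebra Lp (BGen n) → FreeAlgebra Lp (BGen n) → Prop
  | rr (i : Fin n) : BrauerBRel n (fr i * fr i) 1
  | re (i : Fin n) : BrauerBRel n (fr i * fe i) (fe i)
  | er (i : Fin n) : BrauerBRel n (fe i * fr i) (fe i)
  | ee (i : Fin n) (h : 0 < i.val) : BrauerBRel n (fe i * fe i) (δpar • fe i)
  | e0e0 (i : Fin n) (h : i.val = 0) : BrauerBRel n (fe i * fe i) ((δpar * δpar) • fe i)
  | rrFar (i j : Fin n) (h : i.val + 2 ≤ j.val ∨ j.val + 2 ≤ i.val) :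
      BrauerBRel n (fr i * fr j) (fr j * fr i)
  | erFar (i j : Fin n) (h : i.val + 2 ≤ j.val ∨ j.val + 2 ≤ i.val) :
      BrauerBRel n (fe i * fr j) (fr j * fe i)
  | eeFar (i j : Fin n) (h : i.val + 2 ≤ j.val ∨ j.val + 2 ≤ i.val) :
      BrauerBRel n (fe i * fe j) (fe j * fe i)
  | braid (i j : Fin n) (h : i.val + 1 = j.val ∨ j.val + 1 = i.val)
      (hi : 0 < i.val) (hj : 0 < j.val) :
      BrauerBRel n (fr i * fr j * fr i) (fr j * fr i * fr j)
  | rre (i j : Fin n) (h : i.val + 1 = j.val ∨ j.val + 1 = i.val)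
      (hi : 0 < i.val) (hj : 0 < j.val) :
      BrauerBRel n (fr j * fr i * fe j) (fe i * fe j)
  | rer (i j : Fin n) (h : i.val + 1 = j.val ∨ j.val + 1 = i.val)
      (hi : 0 < i.val) (hj : 0 < j.val) :
      BrauerBRel n (fr i * fe j * fr i) (fr j * fe i * fr j)
  | b1010 (i j : Fin n) (h0 : i.val = 0) (h1 : j.val = 1) :
      BrauerBRel n (fr j * fr i * fr j * fr i) (fr i * fr j * fr i * fr j)
  | b_r0r1e0 (i j : Fin n) (h0 : i.val = 0) (h1 : j.val = 1) :
      BrauerBRel n (fr i * fr j * fe i) (fr j * fe i)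
  | b_r0e1r0e1 (i j : Fin n) (h0 : i.val = 0) (h1 : j.val = 1) :
      BrauerBRel n (fr i * fe j * fr i * fe j) (fe j * fe i * fe j)
  | b_r0r1r0e1 (i j : Fin n) (h0 : i.val = 0) (h1 : j.val = 1) :
      BrauerBRel n (fr i * fr j * fr i * fe j) (fe j * (fr i * fr j * fr i))
  | b_e0r1e0 (i j : Fin n) (h0 : i.val = 0) (h1 : j.val = 1) :
      BrauerBRel n (fe i * fr j * fe i) (δpar • fe i)
  | b_e0e1e0 (i j : Fin n) (h0 : i.val = 0) (h1 : j.val = 1) :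
      BrauerBRel n (fe i * fe j * fe i) (δpar • fe i)
  | b_e0r1r0 (i j : Fin n) (h0 : i.val = 0) (h1 : j.val = 1) :
      BrauerBRel n (fe i * fr j * fr i) (fe i * fr j)
  | b_e0e1r0 (i j : Fin n) (h0 : i.val = 0) (h1 : j.val = 1) :
      BrauerBRel n (fe i * fe j * fr i) (fe i * fe j)

/-- The Brauer algebra of type `B_n` over `ℤ[δ, δ⁻¹]`. -/
abbrev BrauerB (n : ℕ) : Type := RingQuot (BrauerBRel n)

/-- The generator `r i` of `Br(B_n)` (defined to be `1` for out-of-range indices). -/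
noncomputable def rb (n : ℕ) (i : ℕ) : BrauerB n :=
  if h : i < n then RingQuot.mkAlgHom Lp (BrauerBRel n) (fr ⟨i, h⟩) else 1

/-- The generator `e i` of `Br(B_n)` (defined to be `1` for out-of-range indices). -/
noncomputable def eb (n : ℕ) (i : ℕ) : BrauerB n :=
  if h : i < n then RingQuot.mkAlgHom Lp (BrauerBRel n) (fe ⟨i, h⟩) else 1


/-- `doubleFactOdd k = (2k-1)!! = 1·3·5⋯(2k-1)`, the number of perfect matchings
of `2k` points (with `doubleFactOdd 0 = 1`). -/
def doubleFactOdd : ℕ → ℕ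
  | 0 => 1
  | (k + 1) => (2 * k + 1) * doubleFactOdd k

/-- `f(n) = 2^{n+1}·(2n-1)!! − 2^n·n! + (2n+1)!! − (n+1)!`, the rank of `Br(B_n)`. -/
def fB (n : ℕ) : ℕ :=
  (2 ^ (n + 1) * doubleFactOdd n - 2 ^ n * Nat.factorial n) +
    (doubleFactOdd (n + 1) - Nat.factorial (n + 1))


open Equiv in
/-- Commutation and contraction laws satisfied in the Brauer algebra of type `B` by a copy of the
symmetric group, a group of sign changes, and the two families of idempotent-like elements
indexed by the roots `εᵢ - εⱼ` (`E i j`) and `εᵢ` (`F i`). -/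
structure BrauerBSystem (ι A : Type*) {R : Type*} [DecidableEq ι] [CommRing R] [Ring A]
    [Algebra R A] (d : R) where
  s : Perm ι →* A
  t : (ι → ℤˣ) →* A
  E : ι → ι → A
  F : ι → A
  s_t (σ : Perm ι) (f : ι → ℤˣ) : s σ * t f = t (f ∘ σ.symm) * s σ
  s_E (σ : Perm ι) {i j : ι} (h : i ≠ j) : s σ * E i j = E (σ i) (σ j) * s σ
  s_F (σ : Perm ι) (i : ι) : s σ * F i = F (σ i) * s σ
  E_symm {i j : ι} (h : i ≠ j) : E i j = E j i
  E_swap {i j : ι} (h : i ≠ j) : E i j * s (swap i j) = E i j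
  E_sq {i j : ι} (h : i ≠ j) : E i j * E i j = d • E i j
  E_mul_E {i j k : ι} (hij : i ≠ j) (hjk : j ≠ k) (hik : i ≠ k) :
    E i j * E j k = E i j * s (swap i k)
  E_comm {i j k l : ι} (hij : i ≠ j) (hkl : k ≠ l) (hik : i ≠ k) (hil : i ≠ l) (hjk : j ≠ k)
    (hjl : j ≠ l) : Commute (E i j) (E k l)
  t_comm_E {i j k : ι} (hij : i ≠ j) (hki : k ≠ i) (hkj : k ≠ j) :
    Commute (t (Pi.mulSingle k (-1))) (E i j)
  tt_comm_E {i j : ι} (h : i ≠ j) :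
    Commute (t (Pi.mulSingle i (-1)) * t (Pi.mulSingle j (-1))) (E i j)
  F_comm_E {i j k : ι} (hij : i ≠ j) (hki : k ≠ i) (hkj : k ≠ j) : Commute (F k) (E i j)
  t_F (f : ι → ℤˣ) (i : ι) : t f * F i = F i
  F_t (f : ι → ℤˣ) (i : ι) : F i * t f = F i
  F_sq (i : ι) : F i * F i = (d * d) • F i
  F_E_F {i j : ι} (h : i ≠ j) : F i * E i j * F i = d • F i
  F_s_F {i j : ι} (h : i ≠ j) : F i * s (swap i j) * F i = d • F i
  E_t_E {i j : ι} (h : i ≠ j) : E i j * t (Pi.mulSingle i (-1)) * E i j = E i j * F i * E i j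
  F_E_t {i j : ι} (h : i ≠ j) : F i * E i j * t (Pi.mulSingle i (-1)) = F i * E i j
  t_E_F {i j : ι} (h : i ≠ j) : t (Pi.mulSingle i (-1)) * E i j * F i = E i j * F i

namespace BrauerBSystem

open Equiv

theorem invol_apply {ι : Type*} {y : Perm ι} (hy : y * y = 1) (x : ι) : y (y x) = x := by
  rw [← Perm.mul_apply, hy, Perm.one_apply]

theorem conj_invol {ι : Type*} {y : Perm ι} (hy : y * y = 1) (σ : Perm ι) :
    (σ * y * σ⁻¹) * (σ * y * σ⁻¹) = 1 := by
  calc _ = σ * (y * y) * σ⁻¹ := by group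
    _ = 1 := by simp [hy]

theorem conj_ne_one {ι : Type*} {y : Perm ι} (hy : y ≠ 1) (σ : Perm ι) : σ * y * σ⁻¹ ≠ 1 := by
  intro h
  exact hy (by simpa [mul_assoc] using congrArg (fun z => σ⁻¹ * z * σ) h)

theorem swap_mul_invol {ι : Type*} [DecidableEq ι] {y : Perm ι} (hy : y * y = 1)
    {i j : ι} (hi : y i = i) (hj : y j = j) :
    (swap i j * y) * (swap i j * y) = 1 := by
  have : swap i j * y = y * swap i j := by rw [mul_swap_eq_swap_mul, hi, hj]
  calc swap i j * y * (swap i j * y) = swap i j * (y * y) * swap i j := by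
        nth_rw 2 [this]; simp only [mul_assoc]
    _ = 1 := by rw [hy, mul_one, swap_mul_self]

theorem ne_one_of_apply {ι : Type*} {y : Perm ι} {i : ι} (h : y i ≠ i) : y ≠ 1 := by
  rintro rfl; exact h rfl

variable {ι A R : Type*} [DecidableEq ι] [CommRing R] [Ring A] [Algebra R A] {d : R}
  (S : BrauerBSystem ι A d)

/-- The sign change at `i`. -/
def τ (i : ι) : A := S.t (Pi.mulSingle i (-1))

theorem τ_mul_self (i : ι) : S.τ i * S.τ i = 1 := by
  rw [τ, ← map_mul, ← Pi.mulSingle_mul]; simp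

theorem τ_comm (i j : ι) : Commute (S.τ i) (S.τ j) := by
  rw [τ, τ, Commute, SemiconjBy, ← map_mul, ← map_mul, mul_comm]

theorem t_mul_comm (f g : ι → ℤˣ) : S.t f * S.t g = S.t g * S.t f := by
  rw [← map_mul, mul_comm, map_mul]

theorem s_τ (σ : Perm ι) (i : ι) : S.s σ * S.τ i = S.τ (σ i) * S.s σ := by
  rw [τ, τ, S.s_t]
  congr 2
  ext k
  simp [Pi.mulSingle_apply, Equiv.symm_apply_eq]

theorem s_swap_mul_self (i j : ι) : S.s (swap i j) * S.s (swap i j) = 1 := by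
  rw [← map_mul, swap_mul_self, map_one]

theorem E_mul_E' {i j k : ι} (hij : i ≠ j) (hjk : j ≠ k) (hik : i ≠ k) :
    S.E i j * S.E j k = S.s (swap i k) * S.E j k := by
  rw [S.E_mul_E hij hjk hik, S.s_E _ hjk, swap_apply_right,
    swap_apply_of_ne_of_ne hij.symm hjk, S.E_symm hij]

theorem E_E_swap_swap {i j k l : ι} (hij : i ≠ j) (hkl : k ≠ l) (hik : i ≠ k) (hil : i ≠ l)
    (hjk : j ≠ k) (hjl : j ≠ l) :
    S.E i j * S.E k l * (S.s (swap i k) * S.s (swap j l)) = S.E i j * S.E k l := by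
  have h1 : S.E i j * S.E k l * S.s (swap i k) = S.E i j * S.E k l * S.s (swap j l) := by
    rw [(S.E_comm hij hkl hik hil hjk hjl).eq, mul_assoc, ← S.E_mul_E hij hjk hik, ← mul_assoc,
      ← (S.E_comm hij hkl hik hil hjk hjl).eq, mul_assoc, S.E_symm hjk, S.E_symm hkl,
      S.E_mul_E hkl.symm hjk.symm hjl.symm, swap_comm l j, ← mul_assoc]
  rw [← mul_assoc, h1, mul_assoc, s_swap_mul_self, mul_one]

theorem F_mul_F {i j : ι} (h : i ≠ j) : S.F i * S.F j = d • (S.s (swap i j) * S.F j) := by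
  have h1 : S.F j = S.s (swap i j) * S.F i * S.s (swap i j) := by
    rw [S.s_F, swap_apply_left, mul_assoc, s_swap_mul_self, mul_one]
  rw [S.s_F, swap_apply_right]
  nth_rw 1 [h1]
  rw [← mul_assoc, ← mul_assoc, S.F_s_F h, smul_mul_assoc]

theorem τ_E_F {i j : ι} (h : i ≠ j) (k : ι) : S.τ i * S.E i j * S.F k = S.E i j * S.F k := by
  by_cases hi : k = i
  · subst hi; exact S.t_E_F h
  by_cases hj : k = j
  · subst hj
    have : S.E i k * S.F k = S.E i k * S.F i * S.s (swap i k) := by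
      conv_lhs => rw [← S.E_swap h]
      rw [mul_assoc, S.s_F, swap_apply_right, mul_assoc]
    rw [mul_assoc, this, ← mul_assoc, ← mul_assoc]
    congr 1
    exact S.t_E_F h
  · rw [mul_assoc, ← (S.F_comm_E h hi hj).eq, ← mul_assoc]
    congr 1
    exact S.t_F _ _

theorem F_E_τ {i j : ι} (h : i ≠ j) (k : ι) : S.F i * S.E i j * S.τ k = S.F i * S.E i j := by
  by_cases hi : k = i
  · subst hi; exact S.F_E_t h
  by_cases hj : k = j
  · subst hj
    have h1 : S.F i * S.E i k * S.τ i = S.F i * S.E i k := S.F_E_t h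
    have h2 : S.τ i * S.τ k * S.E i k = S.E i k * (S.τ i * S.τ k) := (S.tt_comm_E h).eq
    calc S.F i * S.E i k * S.τ k = S.F i * (S.E i k * (S.τ i * S.τ k)) := by
          nth_rw 1 [← h1]; simp only [mul_assoc]
      _ = S.F i * S.E i k := by
          rw [← h2, τ, τ, ← map_mul, ← mul_assoc, S.F_t]
  · have h3 : S.τ k * S.E i j = S.E i j * S.τ k := (S.t_comm_E h hi hj).eq
    rw [mul_assoc, ← h3, ← mul_assoc]
    congr 1
    exact S.F_t _ _

/-- Products of `E i j` over the transpositions of an involution. -/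
inductive Cups : Perm ι → A → Prop
  | one : Cups 1 1
  | cons {y : Perm ι} {a : A} {i j : ι} (hy : Cups y a) (hij : i ≠ j) (hi : y i = i)
      (hj : y j = j) : Cups (swap i j * y) (S.E i j * a)

theorem swap_mul_swap_commute {y : Perm ι} (hy : y * y = 1) {i k : ι}
    (h : swap i k * swap (y i) (y k) = swap (y i) (y k) * swap i k) :
    Commute (swap i k * swap (y i) (y k)) y := by
  have e1 : y * swap i k = swap (y i) (y k) * y := mul_swap_eq_swap_mul ..
  have e2 : y * swap (y i) (y k) = swap i k * y := by
    rw [mul_swap_eq_swap_mul, invol_apply hy, invol_apply hy]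
  rw [Commute, SemiconjBy, mul_assoc, ← e1, ← mul_assoc, ← e2, mul_assoc, ← h]

theorem exists_perm_move {y : Perm ι} (hy : y * y = 1) {i a : ι} (hi : y i ≠ i) (ha : y a ≠ a) :
    ∃ p : Perm ι, Commute p y ∧ (∀ x, y x = x → p x = x) ∧ p i = a := by
  by_cases h1 : a = i
  · exact ⟨1, Commute.one_left _, fun _ _ => rfl, h1.symm⟩
  by_cases h2 : a = y i
  · subst h2
    refine ⟨swap i (y i), ?_, ?_, by simp⟩
    · rw [Commute, SemiconjBy, mul_swap_eq_swap_mul, invol_apply hy, swap_comm]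
    · intro x hx
      apply swap_apply_of_ne_of_ne
      · rintro rfl; exact hi hx
      · rintro rfl; exact ha hx
  have hia : y a ≠ i := fun h => h2 (by rw [← h, invol_apply hy])
  refine ⟨swap i a * swap (y i) (y a), ?_, ?_, ?_⟩
  · apply swap_mul_swap_commute hy
    rw [mul_swap_eq_swap_mul, swap_apply_of_ne_of_ne hi (Ne.symm h2),
      swap_apply_of_ne_of_ne hia ha]
  · intro x hx
    rw [Perm.mul_apply, swap_apply_of_ne_of_ne (a := y i), swap_apply_of_ne_of_ne]
    all_goals rintro rfl
    · exact hi hx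
    · exact ha hx
    · exact hi (y.injective hx)
    · exact ha (y.injective hx)
  · rw [Perm.mul_apply, swap_apply_of_ne_of_ne (Ne.symm hi) hia.symm, swap_apply_left]

variable {S}

theorem Cups.invol {y : Perm ι} {a : A} (h : S.Cups y a) : y * y = 1 := by
  induction h with
  | one => simp
  | @cons y a i j _ hij hi hj ih =>
    have : swap i j * y = y * swap i j := by
      rw [mul_swap_eq_swap_mul, hi, hj]
    calc swap i j * y * (swap i j * y) = swap i j * (y * y) * swap i j := by
          nth_rw 2 [this]; simp only [mul_assoc]
      _ = 1 := by rw [ih, mul_one, swap_mul_self]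

theorem invol_swap_mul {y : Perm ι} (hy : y * y = 1) {i j : ι} (h : y i = j) :
    (swap i j * y) * (swap i j * y) = 1 ∧ (swap i j * y) i = i ∧ (swap i j * y) j = j := by
  have hj : y j = i := by rw [← h, ← Perm.mul_apply, hy, Perm.one_apply]
  refine ⟨?_, by simp [h], by simp [hj]⟩
  have : swap i j * y = y * swap i j := by
    rw [mul_swap_eq_swap_mul, h, hj, swap_comm]
  calc swap i j * y * (swap i j * y) = swap i j * (y * y) * swap i j := by
        nth_rw 2 [this]; simp only [mul_assoc]
    _ = 1 := by rw [hy, mul_one, swap_mul_self]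

theorem Cups.conj {y : Perm ι} {a : A} (h : S.Cups y a) (σ : Perm ι) :
    ∃ b, S.Cups (σ * y * σ⁻¹) b ∧ S.s σ * a = b * S.s σ := by
  induction h with
  | one => exact ⟨1, by simpa using Cups.one, by simp⟩
  | @cons y a i j _ hij hi hj ih =>
    obtain ⟨b, hb, h⟩ := ih
    refine ⟨S.E (σ i) (σ j) * b, ?_, ?_⟩
    · have : σ * (swap i j * y) * σ⁻¹ = swap (σ i) (σ j) * (σ * y * σ⁻¹) := by
        rw [← mul_assoc, mul_swap_eq_swap_mul]; simp only [mul_assoc]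
      rw [this]
      exact .cons hb (σ.injective.ne hij) (by simp [hi]) (by simp [hj])
    · rw [← mul_assoc, S.s_E _ hij, mul_assoc, h, mul_assoc]

theorem Cups.commute {y : Perm ι} {a : A} (h : S.Cups y a) {x : A}
    (hx : ∀ i j, i ≠ j → y i = j → Commute x (S.E i j)) : Commute x a := by
  induction h with
  | one => exact Commute.one_right _
  | @cons y a i j _ hij hi hj ih =>
    refine (hx i j hij (by simp [hi])).mul_right (ih fun k l hkl h => hx k l hkl ?_)
    have h1 : l ≠ i := by rintro rfl; exact hkl (y.injective (h.trans hi.symm))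
    have h2 : l ≠ j := by rintro rfl; exact hkl (y.injective (h.trans hj.symm))
    rw [Perm.mul_apply, h, swap_apply_of_ne_of_ne h1 h2]

theorem Cups.commute_E {y : Perm ι} {a : A} (h : S.Cups y a) {i j : ι} (hij : i ≠ j)
    (hi : y i = i) (hj : y j = j) : Commute (S.E i j) a := by
  refine h.commute fun k l hkl hy => S.E_comm hij hkl ?_ ?_ ?_ ?_
  · rintro rfl; exact hkl (hi.symm.trans hy)
  · rintro rfl; exact hkl (y.injective (hy.trans hi.symm))
  · rintro rfl; exact hkl (hj.symm.trans hy)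
  · rintro rfl; exact hkl (y.injective (hy.trans hj.symm))

theorem Cups.extract {y : Perm ι} {a : A} (h : S.Cups y a) {i j : ι} (hij : i ≠ j)
    (hy : y i = j) : ∃ b, S.Cups (swap i j * y) b ∧ a = S.E i j * b := by
  induction h with
  | one => exact absurd hy hij
  | @cons y a k l hc hkl hk hl ih =>
    by_cases hik : i = k
    · subst hik
      obtain rfl : l = j := by simpa [hk] using hy
      exact ⟨a, by simpa [← mul_assoc] using hc, rfl⟩
    by_cases hil : i = l
    · subst hil
      obtain rfl : k = j := by simpa [hl] using hy
      exact ⟨a, by simpa [← mul_assoc, swap_comm i k] using hc, by rw [S.E_symm hkl]⟩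
    have h1 : y i ≠ k := fun h => hik (y.injective (h.trans hk.symm))
    have h2 : y i ≠ l := fun h => hil (y.injective (h.trans hl.symm))
    have h3 : y i = j := by rwa [Perm.mul_apply, swap_apply_of_ne_of_ne h1 h2] at hy
    rw [h3] at h1 h2
    obtain ⟨b, hb, rfl⟩ := ih h3
    refine ⟨S.E k l * b, ?_, ?_⟩
    · have : swap i j * (swap k l * y) = swap k l * (swap i j * y) := by
        rw [← mul_assoc, ← mul_assoc, mul_swap_eq_swap_mul (swap i j),
          swap_apply_of_ne_of_ne (Ne.symm hik) (Ne.symm h1),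
          swap_apply_of_ne_of_ne (Ne.symm hil) (Ne.symm h2)]
      rw [this]
      refine .cons hb hkl ?_ ?_
      · rw [Perm.mul_apply, hk, swap_apply_of_ne_of_ne (Ne.symm hik) (Ne.symm h1)]
      · rw [Perm.mul_apply, hl, swap_apply_of_ne_of_ne (Ne.symm hil) (Ne.symm h2)]
    · rw [← mul_assoc, ← mul_assoc,
        (S.E_comm hkl hij (Ne.symm hik) h1.symm (Ne.symm hil) h2.symm).eq]

theorem Cups.unique {y : Perm ι} {a b : A} (ha : S.Cups y a) (hb : S.Cups y b) : a = b := by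
  induction ha generalizing b with
  | one =>
    generalize hz : (1 : Perm ι) = z at hb
    cases hb with
    | one => rfl
    | @cons y a k l hc hkl hk hl =>
      have := congrArg (fun z : Perm ι => z k) hz
      simp [hk] at this
      exact absurd this hkl
  | @cons y a i j hc hij hi hj ih =>
    obtain ⟨c, h, rfl⟩ := hb.extract hij (by simp [hi])
    rw [ih (by simpa [← mul_assoc] using h)]

theorem exists_cups [Fintype ι] (y : Perm ι) (hy : y * y = 1) : ∃ a, S.Cups y a := by
  induction h : y.support.card using Nat.strong_induction_on generalizing y with
  | _ n ih =>
    by_cases h1 : y = 1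
    · exact ⟨1, h1 ▸ .one⟩
    obtain ⟨i, hi⟩ : ∃ i, y i ≠ i := by
      by_contra! h; exact h1 (Equiv.ext h)
    obtain ⟨h2, h3, h4⟩ := invol_swap_mul hy (rfl : y i = _)
    obtain ⟨a, ha⟩ := ih _ (h ▸ Perm.card_support_swap_mul hi) _ h2 rfl
    exact ⟨_, by simpa [← mul_assoc] using Cups.cons ha (Ne.symm hi) h3 h4⟩

variable (S)

open Classical in
/-- The product of the `E i j` over the transpositions `(i j)` of the involution `y`. -/
noncomputable def cup (y : Perm ι) : A := if h : ∃ a, S.Cups y a then h.choose else 1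

variable {S}

theorem Cups.eq_cup {y : Perm ι} {a : A} (h : S.Cups y a) : S.cup y = a := by
  have h' : ∃ a, S.Cups y a := ⟨a, h⟩
  rw [cup, dif_pos h']
  exact h'.choose_spec.unique h

variable (S)

theorem cup_one : S.cup 1 = 1 := Cups.one.eq_cup

variable [Fintype ι] {y : Perm ι} (hy : y * y = 1)
include hy

theorem cups_cup : S.Cups y (S.cup y) := by
  obtain ⟨a, ha⟩ := exists_cups (S := S) y hy
  rwa [ha.eq_cup]

theorem cup_swap_mul {i j : ι} (hij : i ≠ j) (hi : y i = i) (hj : y j = j) :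
    S.cup (swap i j * y) = S.E i j * S.cup y :=
  (Cups.cons (S.cups_cup hy) hij hi hj).eq_cup

theorem cup_eq {i j : ι} (hij : i ≠ j) (h : y i = j) :
    S.cup y = S.E i j * S.cup (swap i j * y) := by
  obtain ⟨b, hb, h⟩ := (S.cups_cup hy).extract hij h
  rw [h, hb.eq_cup]

theorem s_cup (σ : Perm ι) : S.s σ * S.cup y = S.cup (σ * y * σ⁻¹) * S.s σ := by
  obtain ⟨b, hb, h⟩ := (S.cups_cup hy).conj σ
  rw [h, hb.eq_cup]

theorem cup_comm_E {i j : ι} (hij : i ≠ j) (hi : y i = i) (hj : y j = j) :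
    Commute (S.cup y) (S.E i j) :=
  ((S.cups_cup hy).commute_E hij hi hj).symm

theorem cup_comm_F {i : ι} (hi : y i = i) : Commute (S.cup y) (S.F i) := by
  refine ((S.cups_cup hy).commute fun k l hkl h => S.F_comm_E hkl ?_ ?_).symm
  · rintro rfl; exact hkl (hi.symm.trans h)
  · rintro rfl; exact hkl (y.injective (h.trans hi.symm))

theorem cup_comm_τ {i : ι} (hi : y i = i) : Commute (S.cup y) (S.τ i) := by
  refine ((S.cups_cup hy).commute fun k l hkl h => S.t_comm_E hkl ?_ ?_).symm
  · rintro rfl; exact hkl (hi.symm.trans h)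
  · rintro rfl; exact hkl (y.injective (h.trans hi.symm))

theorem cup_eq_mul_E {i j : ι} (hij : i ≠ j) (h : y i = j) :
    S.cup y = S.cup (swap i j * y) * S.E i j := by
  obtain ⟨h1, h2, h3⟩ := invol_swap_mul hy h
  rw [S.cup_eq hy hij h, (S.cup_comm_E h1 hij h2 h3).eq]

theorem cup_s_swap {i j : ι} (hij : i ≠ j) (h : y i = j) :
    S.cup y * S.s (swap i j) = S.cup y := by
  rw [S.cup_eq_mul_E hy hij h, mul_assoc, S.E_swap hij]

theorem cup_s_swap_swap {i j k l : ι} (hij : i ≠ j) (hkl : k ≠ l) (hik : i ≠ k) (hil : i ≠ l)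
    (hjk : j ≠ k) (hjl : j ≠ l) (h : y i = j) (h' : y k = l) :
    S.cup y * S.s (swap i k * swap j l) = S.cup y := by
  obtain ⟨h1, h2, h3⟩ := invol_swap_mul hy h
  have h4 : (swap i j * y) k = l := by
    rw [Perm.mul_apply, h', swap_apply_of_ne_of_ne hil.symm hjl.symm]
  rw [S.cup_eq_mul_E hy hij h, S.cup_eq_mul_E h1 hkl h4, mul_assoc _ (S.E k l),
    ← (S.E_comm hij hkl hik hil hjk hjl).eq, mul_assoc, map_mul,
    S.E_E_swap_swap hij hkl hik hil hjk hjl]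

/-- `cup y` absorbs the permutations which commute with `y` and fix the fixed points of `y`. -/
theorem cup_mul_s {h : Perm ι} (hc : Commute h y) (hf : ∀ x, y x = x → h x = x) :
    S.cup y * S.s h = S.cup y := by
  induction hn : h.support.card using Nat.strong_induction_on generalizing h with
  | _ n ih =>
    by_cases h1 : h = 1
    · simp [h1]
    obtain ⟨i, hi⟩ : ∃ i, h i ≠ i := by
      by_contra! hh; exact h1 (Equiv.ext hh)
    have hcx (x) : h (y x) = y (h x) := by
      rw [← Perm.mul_apply, hc.eq, Perm.mul_apply]
    have hij : i ≠ y i := fun h => hi (hf _ h.symm)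
    have step (p : Perm ι) (hp : S.cup y * S.s p = S.cup y) (hpp : p * p = 1)
        (hpy : Commute p y) (hpf : ∀ x, y x = x → p x = x)
        (hs : ∀ x, h x = x → p (h x) = x) (hpi : p (h i) = i) : S.cup y * S.s h = S.cup y := by
      have hlt : (p * h).support.card < n := by
        rw [← hn]
        apply Finset.card_lt_card
        refine (Finset.ssubset_iff_of_subset fun x hx => ?_).2 ⟨i, by simpa using hi, by simpa⟩
        rw [Perm.mem_support] at hx ⊢
        exact fun h => hx (hs x h)
      have := ih _ hlt (hpy.mul_left hc) (fun x hx => by rw [Perm.mul_apply, hf x hx, hpf x hx]) rfl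
      calc S.cup y * S.s h = S.cup y * S.s p * S.s (p * h) := by
            rw [mul_assoc, ← map_mul, ← mul_assoc, hpp, one_mul]
        _ = _ := by rw [hp, this]
    by_cases hk : h i = y i
    · refine step (swap i (y i)) (S.cup_s_swap hy hij rfl) (swap_mul_self _ _) ?_ ?_ ?_ ?_
      · rw [Commute, SemiconjBy, mul_swap_eq_swap_mul, invol_apply hy, swap_comm]
      · intro x hx
        apply swap_apply_of_ne_of_ne
        · rintro rfl; exact hij hx.symm
        · rintro rfl; exact hij (y.injective hx).symm
      · intro x hx
        rw [hx]
        apply swap_apply_of_ne_of_ne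
        · rintro rfl; exact hi hx
        · rintro rfl; rw [hcx] at hx; exact hi (by simpa using hx)
      · simp [hk]
    · have hkl : h i ≠ y (h i) := by rw [← hcx]; exact h.injective.ne hij
      have hil : i ≠ y (h i) := fun hh => hk (by rw [hh, invol_apply hy, ← hh])
      have hjl : y i ≠ y (h i) := y.injective.ne (Ne.symm hi)
      have e (a b c e x : ι) (h1 : x ≠ a) (h2 : x ≠ b) (h3 : x ≠ c) (h4 : x ≠ e) :
          (swap a b * swap c e) x = x := by
        rw [Perm.mul_apply, swap_apply_of_ne_of_ne h3 h4, swap_apply_of_ne_of_ne h1 h2]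
      have hcomm : swap i (h i) * swap (y i) (y (h i)) = swap (y i) (y (h i)) * swap i (h i) := by
        rw [mul_swap_eq_swap_mul, swap_apply_of_ne_of_ne hij.symm (Ne.symm hk),
          swap_apply_of_ne_of_ne hil.symm hkl.symm]
      refine step (swap i (h i) * swap (y i) (y (h i)))
        (S.cup_s_swap_swap hy hij hkl (Ne.symm hi) hil (Ne.symm hk) hjl rfl rfl) ?_ ?_ ?_ ?_ ?_
      · nth_rw 2 [hcomm]
        rw [mul_assoc, ← mul_assoc (swap (y i) _), swap_mul_self, one_mul, swap_mul_self]
      · exact swap_mul_swap_commute hy hcomm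
      · intro x hx
        apply e <;> rintro rfl
        · exact hij hx.symm
        · exact hkl hx.symm
        · exact hij (y.injective hx).symm
        · exact hkl (y.injective hx).symm
      · intro x hx
        rw [hx]
        apply e <;> rintro rfl
        · exact hi hx
        · exact hi (h.injective hx)
        · rw [hcx] at hx; exact hi (y.injective hx)
        · rw [hcx] at hx; exact hi (h.injective (y.injective hx))
      · rw [Perm.mul_apply, swap_apply_of_ne_of_ne hk hkl, swap_apply_right]

theorem s_mul_cup {h : Perm ι} (hc : Commute h y) (hf : ∀ x, y x = x → h x = x) :
    S.s h * S.cup y = S.cup y := by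
  rw [S.s_cup hy, hc.eq, mul_assoc, mul_inv_cancel, mul_one, S.cup_mul_s hy hc hf]

end BrauerBSystem

namespace BrauerBSystem

open Equiv Submodule

set_option linter.unusedSectionVars false

variable {ι A R : Type*} [DecidableEq ι] [Fintype ι] [CommRing R] [Ring A] [Algebra R A] {d : R}
  (S : BrauerBSystem ι A d)

theorem t_induction {P : A → Prop} (h1 : P 1) (h : ∀ k f, P (S.t f) → P (S.τ k * S.t f))
    (f : ι → ℤˣ) : P (S.t f) := by
  have key (s : Finset ι) : P (S.t (∏ i ∈ s, Pi.mulSingle i (f i))) := by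
    induction s using Finset.induction_on with
    | empty => simpa
    | insert a s ha ih =>
      rw [Finset.prod_insert ha]
      rcases Int.units_eq_one_or (f a) with h2 | h2
      · simpa [h2]
      · rw [h2, map_mul]; exact h _ _ ih
  simpa [Finset.univ_prod_mulSingle] using key Finset.univ

theorem F_E_t' {i j : ι} (h : i ≠ j) (f : ι → ℤˣ) : S.F i * S.E i j * S.t f = S.F i * S.E i j :=
  S.t_induction (P := fun a => S.F i * S.E i j * a = S.F i * S.E i j) (by simp)
    (fun k f hf => by rw [← mul_assoc, S.F_E_τ h, hf]) f

theorem E_t {i j : ι} (h : i ≠ j) (f : ι → ℤˣ) :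
    ∃ f' b, (b = 1 ∨ b = S.τ i) ∧ S.E i j * S.t f = S.t f' * S.E i j * b := by
  refine S.t_induction
    (P := fun a => ∃ f' b, (b = 1 ∨ b = S.τ i) ∧ S.E i j * a = S.t f' * S.E i j * b)
    ⟨1, 1, .inl rfl, by simp⟩ ?_ f
  rintro k f ⟨f', b, hb, hf⟩
  have hc : S.E i j * (S.τ k * S.t f) = S.t f' * S.E i j * b * S.τ k := by
    rw [← hf, mul_assoc]
    congr 1
    rw [τ, ← map_mul, mul_comm, map_mul]
  have hbc : b * S.τ i = S.τ i * b := by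
    rcases hb with rfl | rfl
    · simp
    · rfl
  have hbi : b * S.τ i = 1 ∨ b * S.τ i = S.τ i := by
    rcases hb with rfl | rfl
    · simp
    · exact .inl (S.τ_mul_self i)
  by_cases hi : k = i
  · subst hi
    exact ⟨f', b * S.τ k, hbi, by rw [hc, mul_assoc]⟩
  have hbk : b * S.τ k = S.τ k * b := by
    rcases hb with rfl | rfl
    · simp
    · exact (S.τ_comm i k).eq
  by_cases hj : k = j
  · subst hj
    refine ⟨f' * (Pi.mulSingle i (-1) * Pi.mulSingle k (-1)), b * S.τ i, hbi, ?_⟩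
    have h2 : S.τ i * S.τ k * S.E i k = S.E i k * (S.τ i * S.τ k) := (S.tt_comm_E h).eq
    calc _ = S.t f' * (S.E i k * (b * S.τ k)) := by rw [hc]; simp only [mul_assoc]
      _ = S.t f' * (S.E i k * (S.τ k * (S.τ i * S.τ i) * b)) := by
          rw [S.τ_mul_self, mul_one, hbk]
      _ = S.t f' * (S.E i k * (S.τ i * S.τ k) * (b * S.τ i)) := by
          rw [hbc, ← mul_assoc (S.τ k), ← (S.τ_comm i k).eq]; simp only [mul_assoc]
      _ = _ := by rw [← h2, map_mul, map_mul]; simp only [mul_assoc, τ]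
  · refine ⟨f' * Pi.mulSingle k (-1), b, hb, ?_⟩
    have h3 : S.τ k * S.E i j = S.E i j * S.τ k := (S.t_comm_E h hi hj).eq
    calc _ = S.t f' * (S.E i j * (b * S.τ k)) := by rw [hc]; simp only [mul_assoc]
      _ = S.t f' * (S.τ k * S.E i j * b) := by rw [hbk, h3]; simp only [mul_assoc]
      _ = _ := by rw [map_mul]; simp only [mul_assoc, τ]

theorem E_mul_cup {y : Perm ι} (hy : y * y = 1) {k l : ι} (h : k ≠ l) :
    ∃ (c : R) (σ y' : Perm ι), y' * y' = 1 ∧ y' ≠ 1 ∧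
      S.E k l * S.cup y = c • (S.s σ * S.cup y') := by
  by_cases h1 : y k = l
  · refine ⟨d, 1, y, hy, ne_one_of_apply (i := k) (by rw [h1]; exact h.symm), ?_⟩
    rw [map_one, one_mul, S.cup_eq hy h h1, ← mul_assoc, S.E_sq h, smul_mul_assoc]
  by_cases h2 : y k = k
  · by_cases h3 : y l = l
    · refine ⟨1, 1, swap k l * y, swap_mul_invol hy h2 h3,
        ne_one_of_apply (i := k) (by simp [h2, h.symm]), ?_⟩
      rw [S.cup_swap_mul hy h h2 h3]; simp
    · have hkm : y l ≠ k := fun h => h1 (by rw [← h, invol_apply hy])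
      refine ⟨1, swap k (y l), y, hy, ne_one_of_apply h3, ?_⟩
      rw [S.cup_eq hy (Ne.symm h3) rfl, ← mul_assoc, S.E_mul_E' h (Ne.symm h3) hkm.symm]
      simp [mul_assoc]
  · refine ⟨1, swap l (y k), y, hy, ne_one_of_apply h2, ?_⟩
    rw [S.cup_eq hy (Ne.symm h2) rfl, ← mul_assoc, S.E_symm h,
      S.E_mul_E' h.symm (Ne.symm h2) (Ne.symm h1)]
    simp [mul_assoc]

/-- The span of the products `cup y * s u * F p` for a fixed `p`. -/
def cupSpan (p : ι) : Submodule R A :=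
  span R {a | ∃ y u, y * y = 1 ∧ a = S.cup y * S.s u * S.F p}

variable {S} {p : ι} {x : A}

theorem mem_cupSpan {y : Perm ι} (hy : y * y = 1) (u : Perm ι) (p : ι) :
    S.cup y * S.s u * S.F p ∈ S.cupSpan p :=
  subset_span ⟨y, u, hy, rfl⟩

theorem F_mem_cupSpan (p : ι) : S.F p ∈ S.cupSpan p := by
  simpa [S.cup_one] using mem_cupSpan (S := S) (mul_one (1 : Perm ι)) 1 p

theorem cupSpan_induction {N : Submodule R A} (g h : A)
    (H : ∀ y u, y * y = 1 → g * (S.cup y * S.s u * S.F p) * h ∈ N) (hx : x ∈ S.cupSpan p) :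
    g * x * h ∈ N := by
  induction hx using span_induction with
  | mem x hx => obtain ⟨y, u, hy, rfl⟩ := hx; exact H y u hy
  | zero => simp
  | add x y _ _ hx hy => rw [mul_add, add_mul]; exact add_mem hx hy
  | smul c x _ hx => rw [mul_smul_comm, smul_mul_assoc]; exact N.smul_mem _ hx

theorem s_mul_mem_cupSpan (σ : Perm ι) (hx : x ∈ S.cupSpan p) : S.s σ * x ∈ S.cupSpan p := by
  rw [← mul_one (_ * x)]
  refine cupSpan_induction _ _ (fun y u hy => ?_) hx
  rw [mul_one, ← mul_assoc, ← mul_assoc, S.s_cup hy, mul_assoc (S.cup _), ← map_mul]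
  exact mem_cupSpan (conj_invol hy σ) _ _

theorem mul_s_mem_cupSpan (σ : Perm ι) (hx : x ∈ S.cupSpan (σ p)) : x * S.s σ ∈ S.cupSpan p := by
  rw [← one_mul x]
  refine cupSpan_induction _ _ (fun y u hy => ?_) hx
  rw [one_mul, mul_assoc, ← S.s_F, ← mul_assoc, mul_assoc (S.cup _), ← map_mul]
  exact mem_cupSpan hy _ _

theorem E_mul_mem_cupSpan {i j : ι} (hij : i ≠ j) (hx : x ∈ S.cupSpan p) :
    S.E i j * x ∈ S.cupSpan p := by
  rw [← mul_one (_ * x)]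
  refine cupSpan_induction _ _ (fun y u hy => ?_) hx
  obtain ⟨c, σ, y', hy', -, h⟩ := S.E_mul_cup hy hij
  rw [mul_one, ← mul_assoc, ← mul_assoc, h, smul_mul_assoc, smul_mul_assoc, mul_assoc (S.s σ),
    mul_assoc (S.s σ)]
  exact smul_mem _ _ (s_mul_mem_cupSpan σ (mem_cupSpan hy' _ _))

theorem cup_mul_mem_cupSpan {y : Perm ι} (hy : y * y = 1) (hx : x ∈ S.cupSpan p) :
    S.cup y * x ∈ S.cupSpan p := by
  have h := S.cups_cup hy
  generalize S.cup y = a at h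
  induction h with
  | one => simpa
  | cons hc hij _ _ ih => rw [mul_assoc]; exact E_mul_mem_cupSpan hij (ih hc.invol)

theorem τ_mul_cup_F {y : Perm ι} (hy : y * y = 1) (u : Perm ι) (k p : ι) :
    S.τ k * (S.cup y * S.s u * S.F p) = S.cup y * S.s u * S.F p := by
  rw [mul_assoc _ (S.s u), S.s_F, ← mul_assoc, ← mul_assoc, ← mul_assoc]
  congr 1
  by_cases hk : y k = k
  · rw [← (S.cup_comm_τ hy hk).eq, mul_assoc]
    congr 1
    exact S.t_F _ _
  · obtain ⟨h1, h2, h3⟩ := invol_swap_mul hy (rfl : y k = _)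
    rw [S.cup_eq_mul_E hy (Ne.symm hk) rfl, ← mul_assoc, ← (S.cup_comm_τ h1 h2).eq,
      mul_assoc, mul_assoc, mul_assoc, ← mul_assoc (S.τ k), S.τ_E_F (Ne.symm hk)]

theorem t_mul_mem_cupSpan (f : ι → ℤˣ) (hx : x ∈ S.cupSpan p) : S.t f * x ∈ S.cupSpan p := by
  refine S.t_induction (P := fun a => a * x ∈ S.cupSpan p) (by simpa) (fun k f h => ?_) f
  rw [← mul_one (_ * x), mul_assoc (S.τ k)]
  refine cupSpan_induction _ _ (fun y u hy => ?_) h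
  rw [mul_one, τ_mul_cup_F hy]
  exact mem_cupSpan hy _ _

theorem F_mul_mem_cupSpan (k : ι) (hx : x ∈ S.cupSpan p) : S.F k * x ∈ S.cupSpan p := by
  rw [← mul_one (_ * x)]
  refine cupSpan_induction _ _ (fun y u hy => ?_) hx
  rw [mul_one, mul_assoc _ (S.s u), S.s_F, ← mul_assoc, ← mul_assoc]
  apply mul_s_mem_cupSpan
  generalize u p = j
  have hFF (j : ι) : ∃ (c : R) (σ : Perm ι), S.F k * S.F j = c • (S.s σ * S.F j) := by
    by_cases h : k = j
    · subst h; exact ⟨d * d, 1, by rw [S.F_sq]; simp⟩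
    · exact ⟨d, swap k j, S.F_mul_F h⟩
  by_cases hk : y k = k
  · obtain ⟨c, σ, h⟩ := hFF j
    rw [← (S.cup_comm_F hy hk).eq, mul_assoc, h, mul_smul_comm, ← mul_assoc]
    exact smul_mem _ _ (mem_cupSpan hy _ _)
  obtain ⟨h1, h2, h3⟩ := invol_swap_mul hy (rfl : y k = _)
  have hk' : k ≠ y k := Ne.symm hk
  rw [S.cup_eq_mul_E hy hk' rfl, ← mul_assoc, ← (S.cup_comm_F h1 h2).eq, mul_assoc, mul_assoc]
  apply cup_mul_mem_cupSpan h1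
  rw [← mul_assoc]
  by_cases hj : j = k
  · subst hj
    rw [S.F_E_F hk']
    exact smul_mem _ _ (F_mem_cupSpan j)
  by_cases hj' : j = y k
  · subst hj'
    have : S.F k * S.E k (y k) * S.F (y k) = d • (S.cup 1 * S.s (swap k (y k)) * S.F (y k)) := by
      conv_lhs => rw [← S.E_swap hk']
      rw [mul_assoc, mul_assoc, S.s_F, swap_apply_right, ← mul_assoc, ← mul_assoc, S.F_E_F hk',
        S.cup_one, one_mul, S.s_F, swap_apply_right, smul_mul_assoc]
    rw [this]
    exact smul_mem _ _ (mem_cupSpan (by simp) _ _)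
  · obtain ⟨c, σ, h⟩ := hFF j
    rw [mul_assoc, ← (S.F_comm_E hk' hj hj').eq, ← mul_assoc, h, smul_mul_assoc, mul_assoc,
      (S.F_comm_E hk' hj hj').eq]
    refine smul_mem _ _ (s_mul_mem_cupSpan _ (E_mul_mem_cupSpan hk' ?_))
    exact F_mem_cupSpan j

variable (S)

/-- The products in normal form. -/
inductive IsWord : A → Prop
  | unit (f : ι → ℤˣ) (σ : Perm ι) : IsWord (S.t f * S.s σ)
  | cup {y : Perm ι} (hy : y * y = 1) (hne : y ≠ 1) (f g : ι → ℤˣ) (σ : Perm ι) :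
      IsWord (S.t f * S.cup y * S.t g * S.s σ)
  | cupF {y : Perm ι} (hy : y * y = 1) (u : Perm ι) (p : ι) : IsWord (S.cup y * S.s u * S.F p)
  | cupFE {y : Perm ι} (hy : y * y = 1) (u : Perm ι) {i j : ι} (hij : i ≠ j) :
      IsWord (S.cup y * S.s u * S.F i * S.E i j)

/-- The span of the products in normal form. -/
def wordSpan : Submodule R A := span R {a | S.IsWord a}

variable {S}

theorem IsWord.mem {a : A} (h : S.IsWord a) : a ∈ S.wordSpan := subset_span h

theorem cupSpan_mem_wordSpan (hx : x ∈ S.cupSpan p) : x ∈ S.wordSpan := by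
  rw [← mul_one x, ← one_mul x]
  exact cupSpan_induction _ _ (fun y u hy => by simpa using (IsWord.cupF hy u p).mem) hx

theorem cupSpan_mul_E_mem_wordSpan {j : ι} (hj : p ≠ j) (hx : x ∈ S.cupSpan p) :
    x * S.E p j ∈ S.wordSpan := by
  rw [← one_mul x]
  exact cupSpan_induction _ _ (fun y u hy => by simpa using (IsWord.cupFE hy u hj).mem) hx

theorem mul_mem_wordSpan_of {g : A} (hg : ∀ p x, x ∈ S.cupSpan p → g * x ∈ S.cupSpan p)
    (h1 : ∀ f σ, g * (S.t f * S.s σ) ∈ S.wordSpan)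
    (h2 : ∀ y f h σ, y * y = 1 → y ≠ 1 →
      g * (S.t f * S.cup y * S.t h * S.s σ) ∈ S.wordSpan)
    (hx : x ∈ S.wordSpan) : g * x ∈ S.wordSpan := by
  induction hx using span_induction with
  | mem x hx =>
    cases hx with
    | unit f σ => exact h1 f σ
    | cup hy hne f g σ => exact h2 _ f g σ hy hne
    | cupF hy u p => exact cupSpan_mem_wordSpan (hg _ _ (mem_cupSpan hy u p))
    | cupFE hy u hij =>
      rw [← mul_assoc]
      exact cupSpan_mul_E_mem_wordSpan hij (hg _ _ (mem_cupSpan hy u _))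
  | zero => simp
  | add x y _ _ hx hy => rw [mul_add]; exact add_mem hx hy
  | smul c x _ hx => rw [mul_smul_comm]; exact smul_mem _ _ hx

theorem t_mul_mem_wordSpan (f : ι → ℤˣ) (hx : x ∈ S.wordSpan) : S.t f * x ∈ S.wordSpan := by
  refine mul_mem_wordSpan_of (fun p x h => t_mul_mem_cupSpan f h) (fun f' σ => ?_)
    (fun y f' h σ hy hne => ?_) hx
  · rw [← mul_assoc, ← map_mul]
    exact (IsWord.unit _ _).mem
  · rw [← mul_assoc, ← mul_assoc, ← mul_assoc, ← map_mul]
    exact (IsWord.cup hy hne _ _ _).mem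

theorem s_mul_mem_wordSpan (σ : Perm ι) (hx : x ∈ S.wordSpan) : S.s σ * x ∈ S.wordSpan := by
  refine mul_mem_wordSpan_of (fun p x h => s_mul_mem_cupSpan σ h) (fun f' σ' => ?_)
    (fun y f' h σ' hy hne => ?_) hx
  · rw [← mul_assoc, S.s_t, mul_assoc, ← map_mul]
    exact (IsWord.unit _ _).mem
  · have : S.s σ * (S.t f' * S.cup y * S.t h * S.s σ') =
        S.t (f' ∘ σ.symm) * S.cup (σ * y * σ⁻¹) * S.t (h ∘ σ.symm) * S.s (σ * σ') := by
      rw [← mul_assoc, ← mul_assoc, ← mul_assoc, S.s_t, mul_assoc (S.t _), S.s_cup hy,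
        ← mul_assoc, mul_assoc _ (S.s σ) (S.t h), S.s_t, map_mul]
      simp only [mul_assoc]
    rw [this]
    exact (IsWord.cup (conj_invol hy σ) (conj_ne_one hne σ) _ _ _).mem

theorem cup_F_E_s_mem {y : Perm ι} (hy : y * y = 1) {i j : ι} (hij : i ≠ j) (σ : Perm ι) :
    S.cup y * S.F i * S.E i j * S.s σ ∈ S.wordSpan := by
  have h1 : S.F i * S.E i j * S.s σ = S.s σ * S.F (σ.symm i) * S.E (σ.symm i) (σ.symm j) := by
    rw [S.s_F, mul_assoc _ (S.s σ), S.s_E _ (σ.symm.injective.ne hij)]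
    simp [mul_assoc]
  have := (IsWord.cupFE (S := S) hy σ (σ.symm.injective.ne hij)).mem
  rwa [mul_assoc, mul_assoc, ← mul_assoc (S.F i), h1, ← mul_assoc, ← mul_assoc]

theorem E_mul_mem_wordSpan {i j : ι} (hij : i ≠ j) (hx : x ∈ S.wordSpan) :
    S.E i j * x ∈ S.wordSpan := by
  have key (y : Perm ι) (h : ι → ℤˣ) (σ : Perm ι) (hy : y * y = 1) :
      S.E i j * (S.cup y * S.t h * S.s σ) ∈ S.wordSpan := by
    obtain ⟨c, u, y', hy', hne, e⟩ := S.E_mul_cup hy hij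
    rw [← mul_assoc, ← mul_assoc, e, smul_mul_assoc, smul_mul_assoc, mul_assoc, mul_assoc]
    refine smul_mem _ _ (s_mul_mem_wordSpan _ ?_)
    simpa [mul_assoc] using (IsWord.cup (S := S) hy' hne 1 h σ).mem
  have keyτ (y : Perm ι) (h : ι → ℤˣ) (σ : Perm ι) (hy : y * y = 1) :
      S.E i j * S.τ i * (S.cup y * S.t h * S.s σ) ∈ S.wordSpan := by
    by_cases hi : y i = i
    · have : S.E i j * S.τ i * (S.cup y * S.t h * S.s σ) =
          S.E i j * (S.cup y * S.t (Pi.mulSingle i (-1) * h) * S.s σ) := by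
        rw [map_mul, ← mul_assoc (S.cup y), ← τ, (S.cup_comm_τ hy hi).eq]
        simp only [mul_assoc]
      rw [this]
      exact key _ _ _ hy
    obtain ⟨h1, h2, h3⟩ := invol_swap_mul hy (rfl : y i = _)
    by_cases hj : y i = j
    · subst hj
      have : S.E i (y i) * S.τ i * (S.cup y * S.t h * S.s σ) =
          S.cup y * S.F i * S.E i (y i) * S.s σ := by
        have e : S.E i (y i) * S.τ i * S.cup y = S.cup y * S.F i * S.E i (y i) := by
          conv_lhs => rw [S.cup_eq hy hij rfl]
          rw [← mul_assoc, τ, S.E_t_E hij, mul_assoc, ← (S.cup_comm_E h1 hij h2 h3).eq,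
            ← mul_assoc, mul_assoc (S.E _ _), ← (S.cup_comm_F h1 h2).eq, ← mul_assoc,
            ← S.cup_eq hy hij rfl]
        rw [← mul_assoc, ← mul_assoc, e, mul_assoc (S.cup y), mul_assoc (S.cup y),
          S.F_E_t' hij]
      rw [this]
      exact cup_F_E_s_mem hy hij σ
    · set k := y i with hk
      have hik : i ≠ k := Ne.symm hi
      have ec : Commute (S.τ i * S.τ k) (S.cup y) := by
        rw [S.cup_eq hy hik rfl]
        exact Commute.mul_right (S.tt_comm_E hik)
          ((S.cup_comm_τ h1 h2).symm.mul_left (S.cup_comm_τ h1 h3).symm)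
      have h4 : S.τ k * S.E i j = S.E i j * S.τ k := (S.t_comm_E hij hi hj).eq
      have : S.E i j * S.τ i * (S.cup y * S.t h * S.s σ) = S.τ k * (S.E i j *
          (S.cup y * S.t (Pi.mulSingle i (-1) * Pi.mulSingle k (-1) * h) * S.s σ)) := by
        rw [map_mul, map_mul, ← mul_assoc (S.cup y), ← τ, ← τ, ← ec.eq, (S.τ_comm i k).eq]
        simp only [← mul_assoc]
        rw [h4, mul_assoc (S.E i j) (S.τ k), S.τ_mul_self, mul_one]
      rw [this]
      exact t_mul_mem_wordSpan _ (key _ _ _ hy)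
  have main (y : Perm ι) (f h : ι → ℤˣ) (σ : Perm ι) (hy : y * y = 1) :
      S.E i j * (S.t f * S.cup y * S.t h * S.s σ) ∈ S.wordSpan := by
    obtain ⟨f', b, hb, e⟩ := S.E_t hij f
    have : S.E i j * (S.t f * S.cup y * S.t h * S.s σ) =
        S.t f' * (S.E i j * b * (S.cup y * S.t h * S.s σ)) := by
      rw [← mul_assoc, ← mul_assoc, ← mul_assoc, e]
      simp only [mul_assoc]
    rw [this]
    apply t_mul_mem_wordSpan
    rcases hb with rfl | rfl
    · simpa using key _ _ _ hy
    · exact keyτ _ _ _ hy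
  refine mul_mem_wordSpan_of (fun p x h => E_mul_mem_cupSpan hij h) (fun f' σ' => ?_)
    (fun y f' h σ' hy _ => main _ _ _ _ hy) hx
  simpa [S.cup_one] using main 1 f' 1 σ' (by simp)

theorem F_mul_mem_wordSpan (k : ι) (hx : x ∈ S.wordSpan) : S.F k * x ∈ S.wordSpan := by
  have hFs (y : Perm ι) (hy : y * y = 1) (σ : Perm ι) :
      S.cup y * S.F k * S.s σ ∈ S.wordSpan := by
    have : S.F k * S.s σ = S.s σ * S.F (σ.symm k) := by rw [S.s_F, apply_symm_apply]
    rw [mul_assoc, this, ← mul_assoc]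
    exact (IsWord.cupF hy _ _).mem
  refine mul_mem_wordSpan_of (fun p x h => F_mul_mem_cupSpan k h) (fun f' σ' => ?_)
    (fun y f' h σ' hy _ => ?_) hx
  · rw [← mul_assoc, S.F_t]
    simpa [S.cup_one] using hFs 1 (by simp) σ'
  · rw [← mul_assoc, ← mul_assoc, ← mul_assoc, S.F_t]
    by_cases hk : y k = k
    · rw [← (S.cup_comm_F hy hk).eq, mul_assoc (S.cup y), S.F_t]
      exact hFs y hy σ'
    · obtain ⟨h1, h2, h3⟩ := invol_swap_mul hy (rfl : y k = _)
      have hk' : k ≠ y k := Ne.symm hk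
      rw [S.cup_eq_mul_E hy hk' rfl, ← mul_assoc, ← (S.cup_comm_F h1 h2).eq,
        mul_assoc (S.cup _), mul_assoc (S.cup _), S.F_E_t' hk', ← mul_assoc]
      exact cup_F_E_s_mem h1 hk' σ'

theorem one_mem_wordSpan : (1 : A) ∈ S.wordSpan := by
  simpa using (IsWord.unit (S := S) 1 1).mem

end BrauerBSystem

section Matchings

open Equiv

theorem doubleFactOdd_mul (n : ℕ) :
    doubleFactOdd n * (2 ^ n * n.factorial) = (2 * n).factorial := by
  induction n with
  | zero => rfl
  | succ n ih =>
    rw [doubleFactOdd, Nat.mul_succ, Nat.factorial_succ (2 * n + 1), Nat.factorial_succ (2 * n),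
      ← ih, Nat.factorial_succ, pow_succ]
    ring

/-- Perfect matchings of a type, as fixed point free involutions. -/
abbrev Matching (α : Type*) : Type _ := {f : Perm α // f * f = 1 ∧ ∀ x, f x ≠ x}

theorem card_matching_le {α : Type*} [Fintype α] [DecidableEq α] {n : ℕ}
    (h : Fintype.card α = 2 * n) : Fintype.card (Matching α) ≤ doubleFactOdd n := by
  have h1 : Fintype.card (Matching α) ≤
      (Finset.univ.filter fun g : Perm α => g.cycleType = Multiset.replicate n 2).card := by
    rw [Fintype.card_subtype]
    refine Finset.card_le_card fun f hf => ?_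
    simp only [Finset.mem_filter, Finset.mem_univ, true_and] at hf ⊢
    have h2 := Perm.cycleType_of_pow_prime_eq_one (p := 2) (σ := f) (by rw [pow_two, hf.1])
    have h3 : f.support = Finset.univ := by
      ext x; simpa using hf.2 x
    have h4 := f.sum_cycleType
    rw [h3, Finset.card_univ, h, h2, Multiset.sum_replicate, smul_eq_mul] at h4
    rw [h2, show f.cycleType.card = n by omega]
  have h2 := Perm.card_of_cycleType_mul_eq α (Multiset.replicate n 2)
  have hc : ∏ k ∈ (Multiset.replicate n 2).toFinset, ((Multiset.replicate n 2).count k).factorial =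
      n.factorial := by
    rcases Nat.eq_zero_or_pos n with rfl | hn
    · simp
    · rw [Multiset.toFinset_replicate, if_neg hn.ne']; simp
  rw [if_pos ⟨by simp [h, mul_comm], fun a ha => (Multiset.eq_of_mem_replicate ha).ge⟩, hc, h,
    ← doubleFactOdd_mul] at h2
  simp only [Multiset.sum_replicate, smul_eq_mul, mul_comm n 2, Nat.sub_self, Nat.factorial_zero,
    Multiset.prod_replicate, one_mul] at h2
  rw [Nat.eq_of_mul_eq_mul_right (by positivity) h2] at h1
  exact h1

end Matchings

namespace BrauerBSystem

open Equiv

variable {ι : Type*} [DecidableEq ι]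

/-- The cups and caps of `y` together with the vertical strands at the fixed points of `y`. -/
def baseFun (y : Perm ι) : ι ⊕ ι → ι ⊕ ι
  | .inl x => if y x = x then .inr x else .inl (y x)
  | .inr x => if y x = x then .inl x else .inr (y x)

theorem baseFun_invol {y : Perm ι} (hy : y * y = 1) : Function.Involutive (baseFun y) := by
  rintro (x | x) <;> by_cases h : y x = x <;> simp [baseFun, h, invol_apply hy, eq_comm (a := x)]

/-- The diagram of `cup y * s σ`, as a permutation of top and bottom points. -/
def diagram {y : Perm ι} (hy : y * y = 1) (σ : Perm ι) : Perm (ι ⊕ ι) :=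
  (sumCongr 1 σ)⁻¹ * (baseFun_invol hy).toPerm * sumCongr 1 σ

theorem diagram_inl {y : Perm ι} (hy : y * y = 1) (σ : Perm ι) (x : ι) :
    diagram hy σ (.inl x) = if y x = x then .inr (σ⁻¹ x) else .inl (y x) := by
  rw [diagram, Perm.mul_apply, Perm.mul_apply, Perm.inv_eq_iff_eq]
  split_ifs with h <;> simp [baseFun, h]

theorem diagram_inr {y : Perm ι} (hy : y * y = 1) (σ : Perm ι) (x : ι) :
    diagram hy σ (.inr x) = if y (σ x) = σ x then .inl (σ x) else .inr (σ⁻¹ (y (σ x))) := by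
  rw [diagram, Perm.mul_apply, Perm.mul_apply, Perm.inv_eq_iff_eq]
  split_ifs with h <;> simp [baseFun, h]

theorem diagram_isMatching {y : Perm ι} (hy : y * y = 1) (σ : Perm ι) :
    diagram hy σ * diagram hy σ = 1 ∧ ∀ x, diagram hy σ x ≠ x := by
  constructor
  · have h : (baseFun_invol hy).toPerm * (baseFun_invol hy).toPerm = 1 := by
      ext x; simp [baseFun_invol hy x]
    calc _ = (sumCongr 1 σ)⁻¹ * ((baseFun_invol hy).toPerm * (baseFun_invol hy).toPerm) *
          sumCongr 1 σ := by rw [diagram]; group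
      _ = 1 := by rw [h]; simp
  · rintro (x | x)
    · rw [diagram_inl]; split_ifs with h <;> simp [h]
    · rw [diagram_inr]; split_ifs with h <;> simp [Equiv.symm_apply_eq, h]

theorem eq_of_diagram_eq {y y' σ σ' : Perm ι} (hy : y * y = 1) (hy' : y' * y' = 1)
    (h : diagram hy σ = diagram hy' σ') :
    y = y' ∧ Commute (σ' * σ⁻¹) y ∧ ∀ x, y x = x → (σ' * σ⁻¹) x = x := by
  have hl (x) : _ := congrArg (fun f : Perm (ι ⊕ ι) => f (.inl x)) h
  have hr (x) : _ := congrArg (fun f : Perm (ι ⊕ ι) => f (.inr x)) h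
  simp only [diagram_inl, diagram_inr] at hl hr
  have e : y = y' := by
    ext x
    have := hl x
    split_ifs at this with h1 h2 h2
    · rw [h1, h2]
    · exact Sum.inl.inj this
  subst e
  have hf (x) (hx : y x = x) : (σ' * σ⁻¹) x = x := by
    have := hl x
    rw [if_pos hx, if_pos hx] at this
    rw [Perm.mul_apply, Sum.inr.inj this]; simp
  refine ⟨rfl, ?_, hf⟩
  ext z
  rw [Perm.mul_apply, Perm.mul_apply y]
  by_cases hz : y z = z
  · rw [hz, hf z hz, hz]
  · have := hr (σ⁻¹ z)
    rw [show σ (σ⁻¹ z) = z by simp, if_neg hz] at this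
    split_ifs at this with h1
    rw [Perm.mul_apply, Sum.inr.inj this]; simp

/-- The matchings of the form `diagram hy σ` with `y ≠ 1` join two top points. -/
abbrev CupMatching (ι : Type*) : Type _ :=
  {f : Perm (ι ⊕ ι) // (f * f = 1 ∧ ∀ x, f x ≠ x) ∧ ∃ x x', f (.inl x) = .inl x'}

theorem diagram_hasCup {y : Perm ι} (hy : y * y = 1) (hne : y ≠ 1) (σ : Perm ι) :
    ∃ x x', diagram hy σ (.inl x) = .inl x' := by
  obtain ⟨x, hx⟩ : ∃ x, y x ≠ x := by by_contra! h; exact hne (Equiv.ext h)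
  exact ⟨x, y x, by rw [diagram_inl, if_neg hx]⟩

theorem card_cupMatching_le [Fintype ι] :
    Fintype.card (CupMatching ι) + (Fintype.card ι).factorial ≤
      Fintype.card (Matching (ι ⊕ ι)) := by
  rw [← Fintype.card_perm (α := ι), ← Fintype.card_sum]
  refine Fintype.card_le_of_injective
    (Sum.elim (fun f => ⟨f.1, f.2.1⟩)
      (fun σ => ⟨diagram (mul_one (1 : Perm ι)) σ, diagram_isMatching _ σ⟩)) ?_
  refine Function.Injective.sumElim (fun f g h => Subtype.ext (Subtype.mk.inj h))
    (fun σ σ' h => ?_) (fun f σ => ?_)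
  · obtain ⟨-, -, h⟩ := eq_of_diagram_eq _ _ (Subtype.mk.inj h)
    have : σ' * σ⁻¹ = 1 := Equiv.ext fun x => h x rfl
    rw [mul_inv_eq_one] at this
    exact this.symm
  · obtain ⟨f, -, x, x', hx⟩ := f
    rintro h
    obtain rfl := Subtype.mk.inj h
    rw [diagram_inl] at hx
    simp at hx

end BrauerBSystem

namespace BrauerBSystem

open Equiv Submodule

variable {ι A R : Type*} [DecidableEq ι] [Fintype ι] [CommRing R] [Ring A] [Algebra R A] {d : R}
  (S : BrauerBSystem ι A d)

section Signs

variable {y : Perm ι} (hy : y * y = 1)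
include hy

theorem ττ_comm_cup {i : ι} (hi : y i ≠ i) : Commute (S.τ i * S.τ (y i)) (S.cup y) := by
  obtain ⟨h1, h2, h3⟩ := invol_swap_mul hy (rfl : y i = _)
  rw [S.cup_eq hy hi.symm rfl]
  exact Commute.mul_right (S.tt_comm_E hi.symm)
    ((S.cup_comm_τ h1 h2).symm.mul_left (S.cup_comm_τ h1 h3).symm)

theorem ττ_cup_eq {i a : ι} (hi : y i ≠ i) (ha : y a ≠ a) :
    S.τ i * S.τ (y i) * S.cup y = S.τ a * S.τ (y a) * S.cup y := by
  obtain ⟨p, hp, hf, rfl⟩ := exists_perm_move hy hi ha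
  have hpy : p (y i) = y (p i) := by rw [← Perm.mul_apply, hp.eq, Perm.mul_apply]
  calc S.τ i * S.τ (y i) * S.cup y = S.s p * S.cup y * (S.τ i * S.τ (y i)) := by
        rw [(S.ττ_comm_cup hy hi).eq, S.s_mul_cup hy hp hf]
    _ = S.s p * S.τ i * S.τ (y i) * S.cup y := by
        rw [mul_assoc, ← (S.ττ_comm_cup hy hi).eq]; simp only [mul_assoc]
    _ = S.τ (p i) * S.τ (y (p i)) * (S.s p * S.cup y) := by
        rw [S.s_τ, mul_assoc _ (S.s p), S.s_τ, hpy]; simp only [mul_assoc]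
    _ = _ := by rw [S.s_mul_cup hy hp hf]

end Signs

open Classical in
/-- The product of the two signs at the ends of some chosen arc of `y`. -/
noncomputable def arcSign (y : Perm ι) : ι → ℤˣ :=
  if h : ∃ a, y a ≠ a then Pi.mulSingle h.choose (-1) * Pi.mulSingle (y h.choose) (-1) else 1

theorem t_arcSign_mul_cup {y : Perm ι} (hy : y * y = 1) {i : ι} (hi : y i ≠ i) :
    S.t (arcSign y) * S.cup y = S.τ i * S.τ (y i) * S.cup y := by
  have h : ∃ a, y a ≠ a := ⟨i, hi⟩
  rw [arcSign, dif_pos h, map_mul, ← τ, ← τ]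
  exact S.ττ_cup_eq hy h.choose_spec hi

/-- The signs of `p` at the first ends of the arcs of `y`. -/
noncomputable def signL (y : Perm ι) (p : ι → ℤˣ) : ι → ℤˣ :=
  fun i => if Fintype.equivFin ι i < Fintype.equivFin ι (y i) then p i else 1

/-- The signs of `p` at the fixed points of `y` and the second ends of the arcs of `y`. -/
noncomputable def signR (y : Perm ι) (p : ι → ℤˣ) : ι → ℤˣ :=
  fun i => if Fintype.equivFin ι i < Fintype.equivFin ι (y i) then 1 else p i

/-- The normal form of a product of signs around `cup y`. -/
noncomputable def signedCup (y : Perm ι) (p : ι → ℤˣ) (b : Bool) : A :=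
  S.t ((if b then arcSign y else 1) * signL y p) * S.cup y * S.t (signR y p)

omit [DecidableEq ι] in
theorem signL_one (y : Perm ι) : signL y 1 = 1 := by ext; simp [signL]

omit [DecidableEq ι] in
theorem signR_one (y : Perm ι) : signR y 1 = 1 := by ext; simp [signR]

section

variable {y : Perm ι} {p : ι → ℤˣ} {k : ι}

theorem signL_mul_of_lt (h : Fintype.equivFin ι k < Fintype.equivFin ι (y k)) :
    signL y (Pi.mulSingle k (-1) * p) = Pi.mulSingle k (-1) * signL y p := by
  funext i
  by_cases hi : i = k
  · subst hi; simp [signL, h]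
  · simp [signL, Pi.mulSingle_eq_of_ne hi]

theorem signR_mul_of_lt (h : Fintype.equivFin ι k < Fintype.equivFin ι (y k)) :
    signR y (Pi.mulSingle k (-1) * p) = signR y p := by
  funext i
  by_cases hi : i = k
  · subst hi; simp [signR, h]
  · simp [signR, Pi.mulSingle_eq_of_ne hi]

theorem signL_mul_of_not_lt (h : ¬ Fintype.equivFin ι k < Fintype.equivFin ι (y k)) :
    signL y (Pi.mulSingle k (-1) * p) = signL y p := by
  funext i
  by_cases hi : i = k
  · subst hi; simp only [signL, if_neg h]
  · simp [signL, Pi.mulSingle_eq_of_ne hi]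

theorem signR_mul_of_not_lt (h : ¬ Fintype.equivFin ι k < Fintype.equivFin ι (y k)) :
    signR y (Pi.mulSingle k (-1) * p) = Pi.mulSingle k (-1) * signR y p := by
  funext i
  by_cases hi : i = k
  · subst hi; simp only [signR, if_neg h, Pi.mul_apply]
  · simp [signR, Pi.mulSingle_eq_of_ne hi]

end

theorem arcSign_mul_self (y : Perm ι) : arcSign y * arcSign y = 1 := by
  ext i
  simp

theorem arcSign_mul_signedCup {y : Perm ι} (p : ι → ℤˣ) (b : Bool) :
    S.t (arcSign y) * S.signedCup y p b = S.signedCup y p (!b) := by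
  rw [signedCup, signedCup, ← mul_assoc, ← mul_assoc, ← map_mul, ← mul_assoc]
  cases b
  · simp
  · simp [arcSign_mul_self]

variable {y : Perm ι} (hy : y * y = 1)
include hy

theorem τ_mul_signedCup (k : ι) (p : ι → ℤˣ) (b : Bool) :
    ∃ p' b', S.τ k * S.signedCup y p b = S.signedCup y p' b' := by
  by_cases h : Fintype.equivFin ι k < Fintype.equivFin ι (y k)
  · refine ⟨Pi.mulSingle k (-1) * p, b, ?_⟩
    rw [signedCup, signedCup, signL_mul_of_lt h, signR_mul_of_lt h, mul_left_comm, map_mul _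
      (Pi.mulSingle k (-1)), τ]
    simp only [mul_assoc]
  by_cases hk : y k = k
  · refine ⟨Pi.mulSingle k (-1) * p, b, ?_⟩
    rw [signedCup, signedCup, signL_mul_of_not_lt h, signR_mul_of_not_lt h, map_mul _
      (Pi.mulSingle k (-1)), ← τ, ← mul_assoc, ← mul_assoc, τ, t_mul_comm, mul_assoc (S.t _),
      ← τ, ← (S.cup_comm_τ hy hk).eq]
    simp only [mul_assoc]
  · have hlt : Fintype.equivFin ι (y k) < Fintype.equivFin ι (y (y k)) := by
      rw [invol_apply hy]
      exact lt_of_le_of_ne (not_lt.1 h) ((Fintype.equivFin ι).injective.ne hk)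
    refine ⟨Pi.mulSingle (y k) (-1) * p, !b, ?_⟩
    rw [← S.arcSign_mul_signedCup, signedCup, signedCup, signL_mul_of_lt hlt,
      signR_mul_of_lt hlt, mul_left_comm, map_mul _ (Pi.mulSingle (y k) (-1)), ← τ]
    have h1 : S.τ k * S.cup y = S.t (arcSign y) * S.τ (y k) * S.cup y := by
      rw [τ, τ, t_mul_comm, ← τ, mul_assoc, S.t_arcSign_mul_cup hy hk, (S.τ_comm _ _).eq,
        ← mul_assoc, ← mul_assoc, ← τ, S.τ_mul_self, one_mul]
    generalize (if b = true then arcSign y else 1) * signL y p = f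
    calc _ = S.t f * (S.τ k * S.cup y) * S.t (signR y p) := by
          rw [← mul_assoc, ← mul_assoc, τ, t_mul_comm]; simp only [mul_assoc]
      _ = _ := by
          rw [h1, τ, ← map_mul, ← mul_assoc, t_mul_comm]; simp only [mul_assoc, map_mul]

theorem signedCup_mul_τ (k : ι) (p : ι → ℤˣ) (b : Bool) :
    ∃ p' b', S.signedCup y p b * S.τ k = S.signedCup y p' b' := by
  by_cases h : Fintype.equivFin ι k < Fintype.equivFin ι (y k)
  · have hk : y k ≠ k := by intro hk; rw [hk] at h; exact lt_irrefl _ h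
    have hlt : ¬ Fintype.equivFin ι (y k) < Fintype.equivFin ι (y (y k)) := by
      rw [invol_apply hy]; exact h.not_gt
    refine ⟨Pi.mulSingle (y k) (-1) * p, !b, ?_⟩
    rw [← S.arcSign_mul_signedCup, signedCup, signedCup, signL_mul_of_not_lt hlt,
      signR_mul_of_not_lt hlt, map_mul _ (Pi.mulSingle (y k) (-1)), ← τ]
    have h1 : S.cup y * S.τ k = S.t (arcSign y) * S.cup y * S.τ (y k) := by
      rw [S.t_arcSign_mul_cup hy hk, (S.ττ_comm_cup hy hk).eq, mul_assoc, mul_assoc,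
        S.τ_mul_self, mul_one]
    generalize (if b = true then arcSign y else 1) * signL y p = f
    calc _ = S.t f * (S.cup y * S.τ k) * S.t (signR y p) := by
          rw [mul_assoc, τ, t_mul_comm]; simp only [mul_assoc]
      _ = _ := by
          rw [h1, ← mul_assoc, ← mul_assoc, t_mul_comm]; simp only [mul_assoc]
  · refine ⟨Pi.mulSingle k (-1) * p, b, ?_⟩
    rw [signedCup, signedCup, signL_mul_of_not_lt h, signR_mul_of_not_lt h, map_mul _
      (Pi.mulSingle k (-1)), τ, mul_assoc, t_mul_comm]

theorem t_cup_t_eq_signedCup (f g : ι → ℤˣ) :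
    ∃ p b, S.t f * S.cup y * S.t g = S.signedCup y p b := by
  refine S.t_induction (P := fun a => ∃ p b, a * S.cup y * S.t g = S.signedCup y p b) ?_ ?_ f
  · refine S.t_induction (P := fun a => ∃ p b, 1 * S.cup y * a = S.signedCup y p b) ?_ ?_ g
    · exact ⟨1, false, by simp [signedCup, signL_one, signR_one]⟩
    · rintro k f ⟨p, b, h⟩
      rw [τ, t_mul_comm, ← mul_assoc, h]
      exact S.signedCup_mul_τ hy k p b
  · rintro k f ⟨p, b, h⟩
    rw [mul_assoc (S.τ k), mul_assoc (S.τ k), h]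
    exact S.τ_mul_signedCup hy k p b

omit hy

open Classical in
/-- The left factors of the products `cup y * F i * E i j` in normal form. -/
noncomputable def hook (y : Perm ι) (j : Option ι) : A :=
  if h : ∃ a, y a ≠ a then
    j.elim (S.E h.choose (y h.choose) * S.F h.choose) fun j =>
      if y j = j then S.E h.choose (y h.choose) * S.F h.choose * S.E h.choose j else S.F (y j)
  else 1

include hy

theorem cup_F_E_of_apply_eq {i j : ι} (hij : i ≠ j) (h : y j = i) :
    S.cup y * S.F i * S.E i j = S.hook y none * S.cup y := by
  have hyi : y i = j := by rw [← h, invol_apply hy]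
  obtain ⟨h1, h2, h3⟩ := invol_swap_mul hy hyi
  have e : S.cup y * S.F i * S.E i j = S.E i j * S.F i * S.cup y := by
    conv_lhs => rw [S.cup_eq hy hij hyi]
    rw [S.cup_eq_mul_E hy hij hyi, mul_assoc (S.E i j), (S.cup_comm_F h1 h2).eq]
    simp only [mul_assoc]
  have hm : ∃ a, y a ≠ a := ⟨i, by rw [hyi]; exact hij.symm⟩
  obtain ⟨p, hp, hf, ha⟩ := exists_perm_move hy (i := i) (by rw [hyi]; exact hij.symm)
    hm.choose_spec
  have hpj : p j = y hm.choose := by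
    rw [← ha, ← hyi, ← Perm.mul_apply, hp.eq, Perm.mul_apply]
  rw [hook, dif_pos hm, Option.elim_none, ← hpj, ← ha]
  calc S.cup y * S.F i * S.E i j = S.s p * (S.cup y * S.F i * S.E i j) := by
        rw [← mul_assoc, ← mul_assoc, S.s_mul_cup hy hp hf]
    _ = S.E (p i) (p j) * S.F (p i) * (S.s p * S.cup y) := by
        rw [e, ← mul_assoc, ← mul_assoc, S.s_E p hij, mul_assoc _ (S.s p), S.s_F]
        simp only [mul_assoc]
    _ = _ := by rw [S.s_mul_cup hy hp hf]

theorem cup_F_E_of_apply_ne {i j : ι} (hij : i ≠ j) (hj : y j = j) (hi : y i ≠ i) :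
    S.cup y * S.F i * S.E i j = S.hook y (some j) * S.cup y * S.s (swap j (y i)) := by
  set k := y i with hk
  have hkj : k ≠ j := fun h => hij (y.injective ((hk.symm.trans h).trans hj.symm))
  obtain ⟨h1, h2, h3⟩ := invol_swap_mul hy hk.symm
  have h4 : (swap i k * y) j = j := by
    rw [Perm.mul_apply, hj, swap_apply_of_ne_of_ne hij.symm hkj.symm]
  have ec : S.cup y = S.cup (swap i k * y) * S.E i k := S.cup_eq_mul_E hy hi.symm hk.symm
  have ec' : S.cup y = S.E i k * S.cup (swap i k * y) := S.cup_eq hy hi.symm hk.symm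
  have e1 : S.E i j * S.cup y * S.s (swap j k) = S.cup (swap i k * y) * S.E i j := by
    rw [ec, ← mul_assoc, ← (S.cup_comm_E h1 hij h2 h4).eq, mul_assoc (S.cup _), S.E_symm hij,
      S.E_mul_E hij.symm hi.symm hkj.symm, mul_assoc, mul_assoc, S.s_swap_mul_self, mul_one]
  have e : S.cup y * S.F i * S.E i j =
      S.E i k * S.F i * S.E i j * S.cup y * S.s (swap j k) := by
    rw [mul_assoc _ _ (S.s _), mul_assoc _ (S.E i j), ← mul_assoc (S.E i j), e1, ← mul_assoc,
      mul_assoc (S.E i k), ← (S.cup_comm_F h1 h2).eq, ← mul_assoc, ← ec']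
  have hm : ∃ a, y a ≠ a := ⟨i, hi⟩
  obtain ⟨p, hp, hf, ha⟩ := exists_perm_move hy hi hm.choose_spec
  have hpk : p k = y hm.choose := by
    rw [← ha, hk, ← Perm.mul_apply, hp.eq, Perm.mul_apply]
  have hpj : p j = j := hf j hj
  rw [hook, dif_pos hm, Option.elim_some, if_pos hj, ← hpk, ← ha]
  calc S.cup y * S.F i * S.E i j = S.s p * (S.cup y * S.F i * S.E i j) := by
        rw [← mul_assoc, ← mul_assoc, S.s_mul_cup hy hp hf]
    _ = S.E (p i) (p k) * S.F (p i) * S.E (p i) (p j) * (S.s p * S.cup y) * S.s (swap j k) := by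
        rw [e]
        simp only [← mul_assoc]
        rw [S.s_E p hi.symm, mul_assoc _ (S.s p), S.s_F, ← mul_assoc, mul_assoc _ (S.s p),
          S.s_E p hij]
        simp only [mul_assoc]
    _ = _ := by rw [S.s_mul_cup hy hp hf, hpj]

theorem cup_F_E_of_apply_of_apply {i j : ι} (hij : i ≠ j) (hj : y j = j) (hi : y i = i) :
    S.cup y * S.F i * S.E i j =
      S.hook (swap i j * y) (some j) * S.cup (swap i j * y) := by
  have h1 : (swap i j * y) j = i := by rw [Perm.mul_apply, hj, swap_apply_right]
  rw [hook, dif_pos ⟨j, by rw [h1]; exact hij⟩, Option.elim_some, if_neg (by rw [h1]; exact hij),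
    h1, (S.cup_comm_F hy hi).eq, S.cup_swap_mul hy hij hi hj, mul_assoc,
    (S.cup_comm_E hy hij hi hj).eq]

theorem cup_F_E_of_arc {i j : ι} (hij : i ≠ j) (hj : y j ≠ j) (hi : y j ≠ i) :
    S.cup y * S.F i * S.E i j = S.cup y * S.s (swap (y j) i) * S.F (y j) := by
  have hF : S.E j (y j) * S.F i = S.F i * S.E j (y j) := (S.F_comm_E hj.symm hij hi.symm).eq.symm
  have e : S.E j (y j) * S.F i * S.E i j = S.E j (y j) * S.F i * S.s (swap (y j) i) := by
    rw [hF, mul_assoc, mul_assoc, S.E_symm hj.symm, S.E_symm hij, S.E_mul_E hj hij.symm hi]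
  rw [mul_assoc _ (S.s _), S.s_F, swap_apply_left, S.cup_eq_mul_E hy hj.symm rfl,
    mul_assoc (S.cup _), mul_assoc (S.cup _), e]
  simp only [mul_assoc]

end BrauerBSystem

namespace BrauerBSystem

open Equiv Submodule

set_option linter.unusedSectionVars false

variable {ι A R : Type*} [DecidableEq ι] [Fintype ι] [CommRing R] [Ring A] [Algebra R A] {d : R}
  (S : BrauerBSystem ι A d)

open Classical in
/-- A chosen pair `(y, σ)` such that `cup y * s σ` has diagram `m`. -/
noncomputable def rep (m : Perm (ι ⊕ ι)) : Perm ι × Perm ι :=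
  if h : ∃ p : Perm ι × Perm ι, ∃ hy : p.1 * p.1 = 1, diagram hy p.2 = m then h.choose else 1

theorem rep_diagram {y : Perm ι} (hy : y * y = 1) (σ : Perm ι) :
    (rep (diagram hy σ)).1 = y ∧ S.cup y * S.s (rep (diagram hy σ)).2 = S.cup y * S.s σ := by
  have h : ∃ p : Perm ι × Perm ι, ∃ hy' : p.1 * p.1 = 1, diagram hy' p.2 = diagram hy σ :=
    ⟨(y, σ), hy, rfl⟩
  obtain ⟨hy', e⟩ := h.choose_spec
  rw [rep, dif_pos h]
  obtain ⟨h1, h2, h3⟩ := eq_of_diagram_eq hy hy' e.symm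
  refine ⟨h1.symm, ?_⟩
  calc S.cup y * S.s h.choose.2 = S.cup y * S.s (h.choose.2 * σ⁻¹) * S.s σ := by
        rw [mul_assoc, ← map_mul, inv_mul_cancel_right]
    _ = _ := by rw [S.cup_mul_s hy h2 h3]

/-- The labels of a spanning set. -/
abbrev Label (ι : Type*) : Type _ :=
  (((ι → ℤˣ) × Perm ι) ⊕ (CupMatching ι × (ι → ℤˣ) × Bool)) ⊕
    ((ι × Matching (ι ⊕ ι)) ⊕ (Option ι × CupMatching ι))

instance : Fintype (Label ι) := instFintypeSum _ _

/-- The element of the spanning set with a given label. -/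
noncomputable def spanner : Label ι → A
  | .inl (.inl (f, σ)) => S.t f * S.s σ
  | .inl (.inr (m, p, b)) => S.signedCup (rep m.1).1 p b * S.s (rep m.1).2
  | .inr (.inl (p, m)) => S.cup (rep m.1).1 * S.s (rep m.1).2 * S.F p
  | .inr (.inr (j, m)) => S.hook (rep m.1).1 j * S.cup (rep m.1).1 * S.s (rep m.1).2

theorem cup_s_F_mem_range {y : Perm ι} (hy : y * y = 1) (u : Perm ι) (p : ι) :
    S.cup y * S.s u * S.F p ∈ Set.range S.spanner := by
  obtain ⟨h1, h2⟩ := S.rep_diagram hy u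
  refine ⟨.inr (.inl (p, ⟨diagram hy u, diagram_isMatching hy u⟩)), ?_⟩
  rw [spanner, h1, h2]

theorem hook_cup_s_mem_range {y : Perm ι} (hy : y * y = 1) (hne : y ≠ 1) (j : Option ι)
    (u : Perm ι) : S.hook y j * S.cup y * S.s u ∈ Set.range S.spanner := by
  obtain ⟨h1, h2⟩ := S.rep_diagram hy u
  refine ⟨.inr (.inr (j, ⟨diagram hy u, diagram_isMatching hy u, diagram_hasCup hy hne u⟩)), ?_⟩
  rw [spanner, h1, mul_assoc, h2, mul_assoc]

theorem IsWord.mem_range {a : A} (h : S.IsWord a) : a ∈ Set.range S.spanner := by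
  cases h with
  | unit f σ => exact ⟨.inl (.inl (f, σ)), rfl⟩
  | @cup y hy hne f g σ =>
    obtain ⟨h1, h2⟩ := S.rep_diagram hy σ
    set σ' := (rep (diagram hy σ)).2 with hσ
    obtain ⟨p, b, h3⟩ := S.t_cup_t_eq_signedCup hy f ((g ∘ σ) ∘ σ'.symm)
    refine ⟨.inl (.inr (⟨diagram hy σ, diagram_isMatching hy σ, diagram_hasCup hy hne σ⟩, p, b)),
      ?_⟩
    have h4 : S.t g * S.s σ = S.s σ * S.t (g ∘ σ) := by
      rw [S.s_t]; congr 2; ext; simp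
    rw [spanner, h1, ← hσ, ← h3, mul_assoc, mul_assoc, mul_assoc _ (S.t g), h4, ← S.s_t,
      mul_assoc, ← mul_assoc (S.cup y), ← mul_assoc (S.cup y), h2]
  | cupF hy u p => exact S.cup_s_F_mem_range hy u p
  | @cupFE y hy u i j hij =>
    have e : S.cup y * S.s u * S.F i * S.E i j = S.cup y * S.F (u i) * S.E (u i) (u j) * S.s u := by
      rw [mul_assoc _ (S.s u), S.s_F, mul_assoc, mul_assoc, S.s_E u hij]; simp only [mul_assoc]
    rw [e]
    generalize u i = k, u j = l, u.injective.ne hij = hkl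
    by_cases h1 : y l = k
    · rw [S.cup_F_E_of_apply_eq hy hkl h1]
      exact S.hook_cup_s_mem_range hy (ne_one_of_apply (by rw [h1]; exact hkl)) _ _
    by_cases h2 : y l = l
    · by_cases h3 : y k = k
      · rw [S.cup_F_E_of_apply_of_apply hy hkl h2 h3]
        exact S.hook_cup_s_mem_range (swap_mul_invol hy h3 h2)
          (ne_one_of_apply (i := k) (by simp [h3, hkl.symm])) _ _
      · rw [S.cup_F_E_of_apply_ne hy hkl h2 h3, mul_assoc _ (S.s _), ← map_mul]
        exact S.hook_cup_s_mem_range hy (ne_one_of_apply h3) _ _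
    · rw [S.cup_F_E_of_arc hy hkl h2 h1, mul_assoc _ (S.F _)]
      have : S.F (y l) * S.s u = S.s u * S.F (u.symm (y l)) := by rw [S.s_F, apply_symm_apply]
      rw [this, ← mul_assoc, mul_assoc _ _ (S.s u), ← map_mul]
      exact S.cup_s_F_mem_range hy _ _

theorem card_label_le : Fintype.card (Label ι) ≤ fB (Fintype.card ι) := by
  set n := Fintype.card ι with hn
  have h1 : Fintype.card (Matching (ι ⊕ ι)) ≤ doubleFactOdd n :=
    card_matching_le (by rw [Fintype.card_sum, two_mul])
  have h2 := card_cupMatching_le (ι := ι)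
  rw [← hn] at h2
  have hc : Fintype.card (Label ι) = 2 ^ n * n.factorial +
      Fintype.card (CupMatching ι) * (2 ^ n * 2) + (n * Fintype.card (Matching (ι ⊕ ι)) +
        (n + 1) * Fintype.card (CupMatching ι)) := by
    simp only [Label, Fintype.card_sum, Fintype.card_prod, Fintype.card_fun, Fintype.card_perm,
      Fintype.card_units_int, Fintype.card_bool, Fintype.card_option, ← hn]
  rw [hc]
  generalize Fintype.card (Matching (ι ⊕ ι)) = M at *
  generalize Fintype.card (CupMatching ι) = m at *
  obtain ⟨c, hc⟩ := Nat.exists_eq_add_of_le (h2.trans h1)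
  have e1 : 2 ^ (n + 1) * doubleFactOdd n - 2 ^ n * n.factorial =
      2 ^ n * n.factorial + (m + c) * (2 ^ n * 2) := by
    rw [hc, Nat.sub_eq_iff_eq_add (by
      rw [pow_succ]
      nlinarith [Nat.zero_le (2 ^ n * (m + c)), Nat.zero_le (2 ^ n * n.factorial)]), pow_succ]
    ring
  have e2 : doubleFactOdd (n + 1) - (n + 1).factorial =
      n * doubleFactOdd n + (n + 1) * (m + c) := by
    rw [doubleFactOdd, Nat.factorial_succ, hc, Nat.sub_eq_iff_eq_add (by nlinarith)]
    ring
  rw [fB, e1, e2]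
  gcongr <;> omega

theorem exists_finset_span (h : S.wordSpan = ⊤) :
    ∃ T : Finset A, T.card ≤ fB (Fintype.card ι) ∧ span R (T : Set A) = ⊤ := by
  classical
  refine ⟨Finset.univ.image S.spanner, Finset.card_image_le.trans card_label_le, ?_⟩
  rw [eq_top_iff, ← h, wordSpan]
  refine span_mono fun a ha => ?_
  simpa using IsWord.mem_range S ha

end BrauerBSystem

/-- The relations between the adjacent transpositions of `m + 1` points. -/
structure IsBraidFamily {X : Type*} [Monoid X] (m : ℕ) (Q : ℕ → X) : Prop where
  sq {i : ℕ} (h : i < m) : Q i * Q i = 1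
  far {i j : ℕ} (h : i + 2 ≤ j) (hj : j < m) : Q i * Q j = Q j * Q i
  braid {i : ℕ} (h : i + 1 < m) : Q i * Q (i + 1) * Q i = Q (i + 1) * Q i * Q (i + 1)

namespace IsBraidFamily

open Equiv

section

variable {X : Type*} [Monoid X] {m : ℕ} {Q : ℕ → X}

/-- The product `Q (p + l - 1) * ⋯ * Q (p + 1) * Q p`. -/
def descent (Q : ℕ → X) (p : ℕ) : ℕ → X
  | 0 => 1
  | l + 1 => Q (p + l) * descent Q p l

theorem descent_succ_mul (p l : ℕ) : descent Q (p + 1) l * Q p = descent Q p (l + 1) := by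
  induction l with
  | zero => simp [descent]
  | succ l ih =>
    rw [descent, mul_assoc, ih, descent, descent]
    congr 2
    omega

theorem descent_mul_self (hQ : IsBraidFamily m Q) {p : ℕ} (hp : p < m) (l : ℕ) :
    descent Q p (l + 1) * Q p = descent Q (p + 1) l := by
  rw [← descent_succ_mul, mul_assoc, hQ.sq hp, mul_one]

theorem descent_mul_of_lt (hQ : IsBraidFamily m Q) {i p l : ℕ} (hi : i + 2 ≤ p) (hl : p + l ≤ m) :
    descent Q p l * Q i = Q i * descent Q p l := by
  induction l with
  | zero => simp [descent]
  | succ l ih =>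
    rw [descent, mul_assoc, ih (by omega), ← mul_assoc, ← mul_assoc,
      hQ.far (j := p + l) (by omega) (by omega)]

theorem descent_mul_of_gt (hQ : IsBraidFamily m Q) {i p l : ℕ} (hi : p ≤ i) (hil : i + 1 < p + l)
    (hl : p + l ≤ m) : descent Q p l * Q (i + 1) = Q i * descent Q p l := by
  induction l with
  | zero => omega
  | succ l ih =>
    rcases Nat.lt_or_ge (i + 1) (p + l) with h | h
    · rw [descent, mul_assoc, ih h (by omega), ← mul_assoc, ← mul_assoc,
        hQ.far (i := i) (j := p + l) (by omega) (by omega)]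
    · obtain ⟨l, rfl⟩ : ∃ k, l = k + 1 := ⟨l - 1, by omega⟩
      obtain rfl : i = p + l := by omega
      have : descent Q p l * Q (p + l + 1) = Q (p + l + 1) * descent Q p l := by
        clear ih h hil
        have aux : ∀ k ≤ l, descent Q p k * Q (p + l + 1) = Q (p + l + 1) * descent Q p k := by
          intro k hk
          induction k with
          | zero => simp [descent]
          | succ k ihk =>
            rw [descent, mul_assoc, ihk (by omega), ← mul_assoc, ← mul_assoc,
              hQ.far (i := p + k) (by omega) (by omega)]
        exact aux l le_rfl
      rw [descent, descent, mul_assoc, mul_assoc, this, ← add_assoc, ← mul_assoc, ← mul_assoc,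
        ← hQ.braid (by omega)]
      simp only [mul_assoc]

/-- The submonoid generated by the first `k` members of a family. -/
def initial (Q : ℕ → X) (k : ℕ) : Submonoid X := Submonoid.closure (Q '' Set.Iio k)

theorem mem_initial {i k : ℕ} (h : i < k) : Q i ∈ initial Q k :=
  Submonoid.subset_closure ⟨i, h, rfl⟩

theorem exists_of_mem_initial (hQ : IsBraidFamily m Q) {k : ℕ} (hk : k < m) {x : X}
    (hx : x ∈ initial Q (k + 1)) :
    ∃ y ∈ initial Q k, ∃ p l, p + l = k + 1 ∧ x = y * descent Q p l := by
  induction hx using Submonoid.closure_induction_right with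
  | one => exact ⟨1, one_mem _, k + 1, 0, rfl, by simp [descent]⟩
  | mul_right x _ _ hq ih =>
    obtain ⟨i, hi, rfl⟩ := hq
    obtain ⟨y, hy, p, l, hpl, rfl⟩ := ih
    rw [Set.mem_Iio] at hi
    rcases lt_trichotomy i p with h | rfl | h
    · rcases Nat.lt_or_ge (i + 1) p with h' | h'
      · exact ⟨y * Q i, mul_mem hy (mem_initial (by omega)), p, l, hpl, by
          rw [mul_assoc, hQ.descent_mul_of_lt (by omega) (by omega), mul_assoc]⟩
      · obtain rfl : p = i + 1 := by omega
        exact ⟨y, hy, i, l + 1, by omega, by rw [mul_assoc, descent_succ_mul]⟩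
    · obtain ⟨l, rfl⟩ : ∃ k, l = k + 1 := ⟨l - 1, by omega⟩
      exact ⟨y, hy, i + 1, l, by omega, by rw [mul_assoc, hQ.descent_mul_self (by omega)]⟩
    · obtain ⟨i, rfl⟩ : ∃ k, i = k + 1 := ⟨i - 1, by omega⟩
      exact ⟨y * Q i, mul_mem hy (mem_initial (by omega)), p, l, hpl, by
        rw [mul_assoc, hQ.descent_mul_of_gt (by omega) (by omega) (by omega), mul_assoc]⟩

end

variable {M : Type*} [Monoid M] {m : ℕ} {R : ℕ → M}

/-- A family together with the adjacent transpositions of `ℕ`. -/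
def withSwap (R : ℕ → M) (i : ℕ) : Perm ℕ × M := (swap i (i + 1), R i)

theorem isBraidFamily_withSwap (hR : IsBraidFamily m R) : IsBraidFamily m (withSwap R) where
  sq h := Prod.ext (swap_mul_self _ _) (hR.sq h)
  far {i j} h hj := Prod.ext
    (Perm.Disjoint.commute (Perm.disjoint_swap_swap (by simp; omega))) (hR.far h hj)
  braid {i} h := Prod.ext (by
    change swap i (i + 1) * swap (i + 1) (i + 1 + 1) * swap i (i + 1) =
      swap (i + 1) (i + 1 + 1) * swap i (i + 1) * swap (i + 1) (i + 1 + 1)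
    rw [swap_mul_swap_mul_swap (by omega) (by omega), swap_comm i, swap_comm (i + 1) (i + 1 + 1),
      swap_mul_swap_mul_swap (by omega) (by omega), swap_comm]) (hR.braid h)

theorem fst_apply_of_mem_initial {k j : ℕ} (hj : k < j) {x : Perm ℕ × M}
    (hx : x ∈ initial (withSwap R) k) : x.1 j = j := by
  induction hx using Submonoid.closure_induction with
  | one => rfl
  | mem x hx =>
    obtain ⟨i, hi, rfl⟩ := hx
    rw [Set.mem_Iio] at hi
    exact swap_apply_of_ne_of_ne (by omega) (by omega)
  | mul x y _ _ hx hy => rw [Prod.fst_mul, Perm.mul_apply, hy, hx]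

theorem descent_fst_apply (p l : ℕ) : (descent (withSwap R) p l).1 p = p + l := by
  induction l with
  | zero => rfl
  | succ l ih =>
    rw [descent, Prod.fst_mul, Perm.mul_apply, ih]
    exact swap_apply_left _ _

theorem eq_of_fst_eq (hR : IsBraidFamily m R) {k : ℕ} (hk : k ≤ m) {x y : Perm ℕ × M}
    (hx : x ∈ initial (withSwap R) k) (hy : y ∈ initial (withSwap R) k) (h : x.1 = y.1) :
    x = y := by
  induction k generalizing x y with
  | zero =>
    simp only [initial, show Set.Iio 0 = (∅ : Set ℕ) by ext; simp, Set.image_empty,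
      Submonoid.closure_empty, Submonoid.mem_bot] at hx hy
    rw [hx, hy]
  | succ k ih =>
    obtain ⟨x, hxk, p, l, hpl, rfl⟩ := hR.isBraidFamily_withSwap.exists_of_mem_initial hk hx
    obtain ⟨y, hyk, q, l', hql, rfl⟩ := hR.isBraidFamily_withSwap.exists_of_mem_initial hk hy
    have hx' : x.1 (k + 1) = k + 1 := fst_apply_of_mem_initial k.lt_succ_self hxk
    have hy' : y.1 (k + 1) = k + 1 := fst_apply_of_mem_initial k.lt_succ_self hyk
    have hp : (x * descent (withSwap R) p l).1 p = k + 1 := by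
      rw [Prod.fst_mul, Perm.mul_apply, descent_fst_apply, hpl, hx']
    have hq : (y * descent (withSwap R) q l').1 q = k + 1 := by
      rw [Prod.fst_mul, Perm.mul_apply, descent_fst_apply, hql, hy']
    obtain rfl : p = q := by
      rw [h] at hp
      exact (Equiv.injective _) (hp.trans hq.symm)
    obtain rfl : l = l' := by omega
    rw [Prod.fst_mul, Prod.fst_mul] at h
    rw [ih (by omega) hxk hyk (mul_right_cancel h)]

/-- The symmetric group on `m + 1` points is presented by its adjacent transpositions. -/
theorem exists_perm_hom (hR : IsBraidFamily m R) :
    ∃ s : Perm (Fin (m + 1)) →* M, ∀ i : Fin m, s (swap i.castSucc i.succ) = R i := by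
  let φ : Perm (Fin (m + 1)) →* Perm ℕ := Perm.extendDomainHom Fin.equivSubtype
  have hφ (i : Fin m) : φ (swap i.castSucc i.succ) = swap (i : ℕ) (i + 1) := by
    ext x
    simp only [φ, Perm.extendDomainHom_apply]
    by_cases hx : x < m + 1
    · rw [Perm.extendDomain_apply_subtype (p := (· < m + 1)) _ _ hx]
      simp only [swap_apply_def, Fin.ext_iff, Fin.equivSubtype]
      simp
      split_ifs <;> simp_all
    · rw [Perm.extendDomain_apply_not_subtype (p := (· < m + 1)) _ _ hx,
        swap_apply_of_ne_of_ne (by omega) (by omega)]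
  have hex (σ : Perm (Fin (m + 1))) : ∃ a, (φ σ, a) ∈ initial (withSwap R) m := by
    have : σ ∈ Submonoid.closure (Set.range fun i : Fin m => swap i.castSucc i.succ) := by
      rw [Perm.mclosure_swap_castSucc_succ]; trivial
    induction this using Submonoid.closure_induction with
    | one => exact ⟨1, by rw [map_one]; exact one_mem _⟩
    | mem _ h =>
      obtain ⟨i, rfl⟩ := h
      exact ⟨R i, by rw [hφ]; exact mem_initial (Q := withSwap R) i.2⟩
    | mul σ σ' _ _ h h' =>
      obtain ⟨a, ha⟩ := h
      obtain ⟨b, hb⟩ := h'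
      exact ⟨a * b, by rw [map_mul, ← Prod.mk_mul_mk]; exact mul_mem ha hb⟩
  choose s hs using hex
  have huniq {σ : Perm (Fin (m + 1))} {a : M} (h : (φ σ, a) ∈ initial (withSwap R) m) :
      s σ = a := (Prod.mk.inj (hR.eq_of_fst_eq le_rfl (hs σ) h rfl)).2
  refine ⟨⟨⟨s, huniq (by rw [map_one]; exact one_mem _)⟩, fun σ σ' => huniq ?_⟩, fun i => huniq ?_⟩
  · rw [map_mul, ← Prod.mk_mul_mk]; exact mul_mem (hs σ) (hs σ')
  · rw [hφ]; exact mem_initial (Q := withSwap R) i.2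

end IsBraidFamily

namespace Equiv.Perm

theorem mem_of_swap_mem {n : ℕ} {H : Submonoid (Perm (Fin n))} {k : ℕ}
    (hH : ∀ i j : Fin n, k ≤ i.val → j.val = i.val + 1 → swap i j ∈ H) {σ : Perm (Fin n)}
    (hσ : ∀ x : Fin n, x.val < k → σ x = x) : σ ∈ H := by
  have key (l : ℕ) : ∀ i j : Fin n, k ≤ i.val → j.val = i.val + l + 1 → swap i j ∈ H := by
    induction l with
    | zero => simpa using hH
    | succ l ih =>
      intro i j hi hj
      let j' : Fin n := ⟨i + l + 1, by omega⟩
      have h1 := ih i j' hi rfl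
      have h2 := hH j' j (by simp [j']; omega) (by simp [j']; omega)
      have : swap i j = swap j' j * swap i j' * swap j' j := by
        rw [swap_mul_swap_mul_swap, swap_comm] <;> simp [Fin.ext_iff, j'] <;> omega
      rw [this]
      exact mul_mem (mul_mem h2 h1) h2
  have hswap (i j : Fin n) (hi : k ≤ i.val) (hj : k ≤ j.val) : swap i j ∈ H := by
    rcases lt_trichotomy i.val j.val with h | h | h
    · exact key (j - i - 1) i j hi (by omega)
    · rw [Fin.ext h, swap_self]; exact one_mem H
    · rw [swap_comm]; exact key (i - j - 1) j i hj (by omega)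
  induction hc : σ.support.card using Nat.strong_induction_on generalizing σ with
  | _ c ih =>
    by_cases h1 : σ = 1
    · rw [h1]; exact one_mem H
    obtain ⟨x, hx⟩ : ∃ x, σ x ≠ x := by by_contra! h; exact h1 (Equiv.ext h)
    have hxk : k ≤ x.val := by by_contra! h; exact hx (hσ x h)
    have hyk : k ≤ (σ x).val := by by_contra! h; exact hx (σ.injective (hσ _ h))
    have hlt := card_support_swap_mul hx
    have := ih _ (hc ▸ hlt) (σ := swap x (σ x) * σ) (fun z hz => by
      rw [mul_apply, hσ z hz, swap_apply_of_ne_of_ne] <;> rintro rfl <;> omega) rfl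
    rw [← swap_mul_self_mul x (σ x) σ]
    exact mul_mem (hswap _ _ hxk hyk) this

end Equiv.Perm

/-- Elements `r 0, …, r m` and `e 0, …, e m` of an algebra satisfying the relations of the Brauer
algebra of type `B` (only those used below are recorded). -/
structure IsBrauerBFamily {A R : Type*} [CommRing R] [Ring A] [Algebra R A] (m : ℕ) (d : R)
    (r e : ℕ → A) : Prop where
  isUnit : IsUnit d
  rr {i : ℕ} (h : i ≤ m) : r i * r i = 1
  re {i : ℕ} (h : i ≤ m) : r i * e i = e i
  er {i : ℕ} (h : i ≤ m) : e i * r i = e i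
  ee {i : ℕ} (h : i ≤ m) (hi : 0 < i) : e i * e i = d • e i
  e0e0 : e 0 * e 0 = (d * d) • e 0
  rr_far {i j : ℕ} (h : i + 2 ≤ j) (hj : j ≤ m) : r i * r j = r j * r i
  er_far {i j : ℕ} (h : i + 2 ≤ j ∨ j + 2 ≤ i) (hi : i ≤ m) (hj : j ≤ m) : e i * r j = r j * e i
  ee_far {i j : ℕ} (h : i + 2 ≤ j) (hj : j ≤ m) : e i * e j = e j * e i
  braid {i : ℕ} (hi : 0 < i) (h : i + 1 ≤ m) : r i * r (i + 1) * r i = r (i + 1) * r i * r (i + 1)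
  rre {i : ℕ} (hi : 0 < i) (h : i + 1 ≤ m) : r (i + 1) * r i * e (i + 1) = e i * e (i + 1)
  rer {i : ℕ} (hi : 0 < i) (h : i + 1 ≤ m) : r i * e (i + 1) * r i = r (i + 1) * e i * r (i + 1)
  r1010 (h : 1 ≤ m) : r 1 * r 0 * r 1 * r 0 = r 0 * r 1 * r 0 * r 1
  r0r1e0 (h : 1 ≤ m) : r 0 * r 1 * e 0 = r 1 * e 0
  r0e1r0e1 (h : 1 ≤ m) : r 0 * e 1 * r 0 * e 1 = e 1 * e 0 * e 1
  r0r1r0e1 (h : 1 ≤ m) : r 0 * r 1 * r 0 * e 1 = e 1 * (r 0 * r 1 * r 0)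
  e0r1e0 (h : 1 ≤ m) : e 0 * r 1 * e 0 = d • e 0
  e0e1e0 (h : 1 ≤ m) : e 0 * e 1 * e 0 = d • e 0
  e0r1r0 (h : 1 ≤ m) : e 0 * r 1 * r 0 = e 0 * r 1
  e0e1r0 (h : 1 ≤ m) : e 0 * e 1 * r 0 = e 0 * e 1

namespace IsBrauerBFamily

open Equiv

/-- The `k`-th of `m + 1` points. -/
abbrev pt (m k : ℕ) : Fin (m + 1) := Fin.ofNat (m + 1) k

theorem pt_val {m k : ℕ} (h : k ≤ m) : (pt m k).val = k := Nat.mod_eq_of_lt (by omega)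

theorem pt_ne {m k l : ℕ} (hk : k ≤ m) (hl : l ≤ m) (h : k ≠ l) : pt m k ≠ pt m l := by
  rw [Ne, Fin.ext_iff, pt_val hk, pt_val hl]; exact h

/-- A permutation taking the first two points to `i` and `j`. -/
def pairPerm (m : ℕ) (i j : Fin (m + 1)) : Perm (Fin (m + 1)) :=
  swap (swap (pt m 0) i (pt m 1)) j * swap (pt m 0) i

theorem one_le_of_ne {m : ℕ} {i j : Fin (m + 1)} (h : i ≠ j) : 1 ≤ m := by omega

theorem pairPerm_zero {m : ℕ} {i j : Fin (m + 1)} (h : i ≠ j) : pairPerm m i j (pt m 0) = i := by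
  have := one_le_of_ne h
  rw [pairPerm, Perm.mul_apply, swap_apply_left, swap_apply_of_ne_of_ne _ h]
  nth_rw 1 [← swap_apply_left (pt m 0) i]
  exact (Equiv.injective _).ne (pt_ne (by omega) this (by omega))

theorem pairPerm_one {m : ℕ} (i j : Fin (m + 1)) : pairPerm m i j (pt m 1) = j := by
  rw [pairPerm, Perm.mul_apply, swap_apply_left]

theorem exists_perm_two {m : ℕ} {i j : Fin (m + 1)} (h : i ≠ j) :
    ∃ π : Perm (Fin (m + 1)), π (pt m 0) = i ∧ π (pt m 1) = j :=
  ⟨_, pairPerm_zero h, pairPerm_one i j⟩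

theorem exists_perm_three {m : ℕ} {i j k : Fin (m + 1)} (hij : i ≠ j) (hjk : j ≠ k) (hik : i ≠ k) :
    2 ≤ m ∧ ∃ π : Perm (Fin (m + 1)), π (pt m 0) = i ∧ π (pt m 1) = j ∧ π (pt m 2) = k := by
  have hm : 2 ≤ m := by omega
  obtain ⟨π, rfl, rfl⟩ := exists_perm_two hij
  refine ⟨hm, swap (π (pt m 2)) k * π, ?_, ?_, ?_⟩
  · rw [Perm.mul_apply, swap_apply_of_ne_of_ne (π.injective.ne (pt_ne _ _ _)) hik] <;> omega
  · rw [Perm.mul_apply, swap_apply_of_ne_of_ne (π.injective.ne (pt_ne _ _ _)) hjk] <;> omega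
  · rw [Perm.mul_apply, swap_apply_left]

theorem exists_perm_four {m : ℕ} {i j k l : Fin (m + 1)} (hij : i ≠ j) (hkl : k ≠ l) (hik : i ≠ k)
    (hil : i ≠ l) (hjk : j ≠ k) (hjl : j ≠ l) :
    3 ≤ m ∧ ∃ π : Perm (Fin (m + 1)),
      π (pt m 0) = i ∧ π (pt m 1) = j ∧ π (pt m 2) = k ∧ π (pt m 3) = l := by
  have hm : 3 ≤ m := by omega
  obtain ⟨-, π, rfl, rfl, rfl⟩ := exists_perm_three hij hjk hik
  refine ⟨hm, swap (π (pt m 3)) l * π, ?_, ?_, ?_, ?_⟩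
  · rw [Perm.mul_apply, swap_apply_of_ne_of_ne (π.injective.ne (pt_ne _ _ _)) hil] <;> omega
  · rw [Perm.mul_apply, swap_apply_of_ne_of_ne (π.injective.ne (pt_ne _ _ _)) hjl] <;> omega
  · rw [Perm.mul_apply, swap_apply_of_ne_of_ne (π.injective.ne (pt_ne _ _ _)) hkl] <;> omega
  · rw [Perm.mul_apply, swap_apply_left]

theorem sign_induction {m : ℕ} {p : (Fin (m + 1) → ℤˣ) → Prop} (f : Fin (m + 1) → ℤˣ) (one : p 1)
    (mul : ∀ f g, p f → p g → p (f * g)) (single : ∀ i, p (Pi.mulSingle i (-1))) : p f := by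
  refine Pi.mulSingle_induction p f one mul fun i u => ?_
  rcases Int.units_eq_one_or u with rfl | rfl
  · simpa using one
  · exact single i

variable {A R : Type*} [CommRing R] [Ring A] [Algebra R A] {m : ℕ} {d : R} {r e : ℕ → A}
  (h : IsBrauerBFamily m d r e)

include h

theorem isBraidFamily : IsBraidFamily m fun i => r (i + 1) where
  sq hi := h.rr hi
  far hij hj := h.rr_far (by omega) hj
  braid hi := h.braid (by omega) (by omega)

/-- The action of permutations of the points. -/
noncomputable def s : Perm (Fin (m + 1)) →* A := h.isBraidFamily.exists_perm_hom.choose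

theorem s_swap {k : ℕ} (hk : k < m) : h.s (swap (pt m k) (pt m (k + 1))) = r (k + 1) := by
  rw [← h.isBraidFamily.exists_perm_hom.choose_spec ⟨k, hk⟩]
  have h1 : pt m k = (⟨k, hk⟩ : Fin m).castSucc := Fin.ext (pt_val hk.le)
  have h2 : pt m (k + 1) = (⟨k, hk⟩ : Fin m).succ := Fin.ext (pt_val hk)
  rw [h1, h2, s]

theorem s_mul_s_inv (σ : Perm (Fin (m + 1))) : h.s σ * h.s σ⁻¹ = 1 := by
  rw [← map_mul, mul_inv_cancel, map_one]

theorem s_inv_mul_s (σ : Perm (Fin (m + 1))) : h.s σ⁻¹ * h.s σ = 1 := by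
  rw [← map_mul, inv_mul_cancel, map_one]

theorem s_inv_mul_s_mul (σ : Perm (Fin (m + 1))) (a : A) : h.s σ⁻¹ * (h.s σ * a) = a := by
  rw [← mul_assoc, s_inv_mul_s, one_mul]

/-- Conjugation by a permutation. -/
noncomputable def conj (σ : Perm (Fin (m + 1))) : A →ₐ[R] A :=
  AlgHom.ofLinearMap (LinearMap.mulLeft R (h.s σ) ∘ₗ LinearMap.mulRight R (h.s σ⁻¹))
    (by simp [s_mul_s_inv])
    (fun a b => by simp [mul_assoc, s_inv_mul_s_mul])

theorem conj_apply (σ : Perm (Fin (m + 1))) (a : A) : h.conj σ a = h.s σ * a * h.s σ⁻¹ := by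
  simp [conj, mul_assoc]

theorem conj_mul_s (σ : Perm (Fin (m + 1))) (a : A) : h.conj σ a * h.s σ = h.s σ * a := by
  rw [conj_apply, mul_assoc, s_inv_mul_s, mul_one]

theorem conj_conj (σ π : Perm (Fin (m + 1))) (a : A) :
    h.conj σ (h.conj π a) = h.conj (σ * π) a := by
  rw [conj_apply, conj_apply, conj_apply, mul_inv_rev, map_mul, map_mul]
  simp only [mul_assoc]

theorem conj_s_swap (σ : Perm (Fin (m + 1))) (i j : Fin (m + 1)) :
    h.conj σ (h.s (swap i j)) = h.s (swap (σ i) (σ j)) := by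
  rw [conj_apply, ← map_mul, ← map_mul, swap_apply_apply]

theorem conj_swap_pt {k : ℕ} (hk : k < m) (a : A) :
    h.conj (swap (pt m k) (pt m (k + 1))) a = r (k + 1) * a * r (k + 1) := by
  rw [conj_apply, swap_inv, h.s_swap hk]

theorem conj_eq_conj {X : A} {k : ℕ} (hX : ∀ i < m, k ≤ i → Commute (r (i + 1)) X)
    {σ π : Perm (Fin (m + 1))} (hσ : ∀ x : Fin (m + 1), x.val < k → σ x = π x) :
    h.conj σ X = h.conj π X := by
  let H : Submonoid (Perm (Fin (m + 1))) :=
    { carrier := {ρ | Commute (h.s ρ) X}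
      one_mem' := by simp
      mul_mem' := fun ha hb => by
        simp only [Set.mem_ofPred_eq, map_mul] at *
        exact ha.mul_left hb }
  have : π⁻¹ * σ ∈ H := by
    refine Perm.mem_of_swap_mem (k := k) (fun i j hi hij => ?_) fun x hx => by
      rw [Perm.mul_apply, hσ x hx]; simp
    have h1 : i = pt m i := Fin.ext (pt_val (by omega)).symm
    have h2 : j = pt m (i + 1) := Fin.ext (hij.trans (pt_val (by omega)).symm)
    change Commute (h.s (swap i j)) X
    rw [h2, h1, pt_val (by omega), h.s_swap (by omega)]
    exact hX i (by omega) hi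
  have h3 : h.conj (π⁻¹ * σ) X = X := by
    have : Commute (h.s (π⁻¹ * σ)) X := this
    rw [conj_apply, this.eq, mul_assoc, s_mul_s_inv, mul_one]
  nth_rw 2 [← h3]
  rw [conj_conj, mul_inv_cancel_left]

/-- The sign change at a point. -/
noncomputable def T (i : Fin (m + 1)) : A := h.conj (swap (pt m 0) i) (r 0)

/-- The idempotent-like element at a point. -/
noncomputable def F (i : Fin (m + 1)) : A := h.conj (swap (pt m 0) i) (e 0)

/-- The idempotent-like element at a pair of points. -/
noncomputable def E (i j : Fin (m + 1)) : A := h.conj (pairPerm m i j) (e 1)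

theorem conj_r_zero (σ : Perm (Fin (m + 1))) : h.conj σ (r 0) = h.T (σ (pt m 0)) := by
  refine h.conj_eq_conj (k := 1) (fun i hi h1 => (h.rr_far (by omega) hi).symm) fun x hx => ?_
  obtain rfl : x = pt m 0 := Fin.ext (by rw [pt_val m.zero_le]; omega)
  rw [swap_apply_left]

theorem conj_e_zero (σ : Perm (Fin (m + 1))) : h.conj σ (e 0) = h.F (σ (pt m 0)) := by
  refine h.conj_eq_conj (k := 1)
    (fun i hi h1 => (h.er_far (by omega) (by omega) hi).symm) fun x hx => ?_
  obtain rfl : x = pt m 0 := Fin.ext (by rw [pt_val m.zero_le]; omega)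
  rw [swap_apply_left]

theorem conj_e_one (hm : 1 ≤ m) (σ : Perm (Fin (m + 1))) :
    h.conj σ (e 1) = h.E (σ (pt m 0)) (σ (pt m 1)) := by
  refine h.conj_eq_conj (k := 2)
    (fun i hi h1 => (h.er_far (by omega) hm hi).symm) fun x hx => ?_
  obtain rfl | rfl : x = pt m 0 ∨ x = pt m 1 := by
    rw [Fin.ext_iff, Fin.ext_iff, pt_val m.zero_le, pt_val hm]; omega
  · rw [pairPerm_zero (σ.injective.ne (pt_ne (by omega) hm (by omega)))]
  · rw [pairPerm_one]

theorem conj_T (σ : Perm (Fin (m + 1))) (i : Fin (m + 1)) : h.conj σ (h.T i) = h.T (σ i) := by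
  rw [T, conj_conj, conj_r_zero, Perm.mul_apply, swap_apply_left]

theorem conj_F (σ : Perm (Fin (m + 1))) (i : Fin (m + 1)) : h.conj σ (h.F i) = h.F (σ i) := by
  rw [F, conj_conj, conj_e_zero, Perm.mul_apply, swap_apply_left]

theorem conj_E (σ : Perm (Fin (m + 1))) {i j : Fin (m + 1)} (hij : i ≠ j) :
    h.conj σ (h.E i j) = h.E (σ i) (σ j) := by
  rw [E, conj_conj, h.conj_e_one (one_le_of_ne hij), Perm.mul_apply, Perm.mul_apply,
    pairPerm_zero hij, pairPerm_one]

theorem T_zero : h.T (pt m 0) = r 0 := by simpa [conj_apply] using (h.conj_r_zero 1).symm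

theorem F_zero : h.F (pt m 0) = e 0 := by simpa [conj_apply] using (h.conj_e_zero 1).symm

theorem T_one (hm : 1 ≤ m) : h.T (pt m 1) = r 1 * r 0 * r 1 := by
  rw [← h.conj_swap_pt hm, conj_r_zero, swap_apply_left]

theorem r_mul_r_mul {i : ℕ} (hi : i ≤ m) (a : A) : r i * (r i * a) = a := by
  rw [← mul_assoc, h.rr hi, one_mul]

theorem E_pt {k : ℕ} (hk : k + 1 ≤ m) : h.E (pt m k) (pt m (k + 1)) = e (k + 1) := by
  induction k with
  | zero =>
    have := h.conj_e_one hk 1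
    simpa [conj_apply] using this.symm
  | succ k ih =>
    have hr := h.rer (i := k + 1) (by omega) hk
    have h1 : e (k + 1 + 1) = h.conj (swap (pt m k) (pt m (k + 1)) *
        swap (pt m (k + 1)) (pt m (k + 1 + 1))) (e (k + 1)) := by
      rw [← conj_conj, h.conj_swap_pt hk, h.conj_swap_pt (by omega), ← hr]
      simp only [mul_assoc, h.rr (i := k + 1) (by omega), h.r_mul_r_mul (i := k + 1) (by omega),
        mul_one]
    have n1 : pt m k ≠ pt m (k + 1) := pt_ne (by omega) (by omega) (by omega)
    have n2 : pt m k ≠ pt m (k + 1 + 1) := pt_ne (by omega) (by omega) (by omega)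
    have n3 : pt m (k + 1 + 1) ≠ pt m (k + 1) := pt_ne (by omega) (by omega) (by omega)
    rw [h1, ← ih (by omega), h.conj_E _ n1, Perm.mul_apply, Perm.mul_apply, swap_apply_left,
      swap_apply_of_ne_of_ne n1 n2, swap_apply_left, swap_apply_of_ne_of_ne n2.symm n3]

theorem s_swap_zero_two (hm : 2 ≤ m) : h.s (swap (pt m 0) (pt m 2)) = r 1 * r 2 * r 1 := by
  have h1 := h.s_swap (k := 0) (by omega)
  have h2 := h.s_swap (k := 1) (by omega)
  have h3 := h.conj_s_swap (swap (pt m 0) (pt m 1)) (pt m 1) (pt m 2)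
  rw [h2, h.conj_swap_pt (by omega), swap_apply_right,
    swap_apply_of_ne_of_ne (pt_ne _ _ _) (pt_ne _ _ _)] at h3 <;> first | omega | exact h3.symm

theorem commute_T (i j : Fin (m + 1)) : Commute (h.T i) (h.T j) := by
  obtain rfl | hij := eq_or_ne i j
  · exact Commute.refl _
  have hm := one_le_of_ne hij
  obtain ⟨π, rfl, rfl⟩ := exists_perm_two hij
  rw [← conj_T, ← conj_T, h.T_zero, h.T_one hm]
  refine Commute.map ?_ (h.conj π)
  have := h.r1010 hm
  simpa only [Commute, SemiconjBy, mul_assoc] using this.symm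

theorem T_mul_self (i : Fin (m + 1)) : h.T i * h.T i = 1 := by
  rw [T, ← map_mul, h.rr m.zero_le, map_one]

/-- The action of the sign changes at a point. -/
noncomputable def signHom (i : Fin (m + 1)) : ℤˣ →* A where
  toFun u := if u = 1 then 1 else h.T i
  map_one' := if_pos rfl
  map_mul' u v := by
    rcases Int.units_eq_one_or u with rfl | rfl <;> rcases Int.units_eq_one_or v with rfl | rfl <;>
      simp [T_mul_self]

theorem signHom_commute :
    Pairwise fun i j => ∀ u v : ℤˣ, Commute (h.signHom i u) (h.signHom j v) := by
  intro i j _ u v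
  simp only [signHom, MonoidHom.coe_mk, OneHom.coe_mk]
  split_ifs <;> simp [commute_T]

/-- The action of the sign changes. -/
noncomputable def t : (Fin (m + 1) → ℤˣ) →* A :=
  MonoidHom.noncommPiCoprod h.signHom h.signHom_commute

theorem t_mulSingle (i : Fin (m + 1)) : h.t (Pi.mulSingle i (-1)) = h.T i := by
  rw [t, MonoidHom.noncommPiCoprod_mulSingle]
  simp [signHom]

theorem s_t (σ : Perm (Fin (m + 1))) (f : Fin (m + 1) → ℤˣ) :
    h.s σ * h.t f = h.t (f ∘ σ.symm) * h.s σ := by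
  induction f using sign_induction with
  | one => simp [Pi.one_comp]
  | mul f g hf hg =>
    rw [map_mul, ← mul_assoc, hf, mul_assoc, hg, ← mul_assoc, ← map_mul]; rfl
  | single i =>
    have : Pi.mulSingle i (-1) ∘ σ.symm = Pi.mulSingle (σ i) (-1 : ℤˣ) := by
      ext k; simp [Pi.mulSingle_apply, symm_apply_eq]
    rw [this, t_mulSingle, t_mulSingle, ← conj_T, conj_mul_s]

theorem T_F (i j : Fin (m + 1)) : h.T i * h.F j = h.F j := by
  obtain rfl | hij := eq_or_ne i j
  · rw [T, F, ← map_mul, h.re m.zero_le]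
  have hm := one_le_of_ne hij
  obtain ⟨π, rfl, rfl⟩ := exists_perm_two hij.symm
  rw [← conj_T, ← conj_F, ← map_mul, h.T_one hm, h.F_zero, mul_assoc, mul_assoc, ← mul_assoc (r 0),
    h.r0r1e0 hm, h.r_mul_r_mul hm]

theorem F_T (i j : Fin (m + 1)) : h.F j * h.T i = h.F j := by
  obtain rfl | hij := eq_or_ne i j
  · rw [T, F, ← map_mul, h.er m.zero_le]
  have hm := one_le_of_ne hij
  obtain ⟨π, rfl, rfl⟩ := exists_perm_two hij.symm
  rw [← conj_T, ← conj_F, ← map_mul, h.T_one hm, h.F_zero, ← mul_assoc, ← mul_assoc,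
    h.e0r1r0 hm, mul_assoc, h.rr hm, mul_one]

theorem e1_r0_e1 (hm : 1 ≤ m) : e 1 * r 0 * e 1 = e 1 * e 0 * e 1 := by
  have h1 := h.r0e1r0e1 hm
  have h2 : r 0 * e 1 * r 0 * e 1 * r 0 = r 0 * e 1 * r 0 * e 1 := by
    rw [h1, mul_assoc, mul_assoc, ← mul_assoc (e 0), h.e0e1r0 hm]
    simp only [mul_assoc]
  have h3 : e 1 * r 0 * e 1 * r 0 = e 1 * r 0 * e 1 := by
    have := congrArg (r 0 * ·) h2
    simpa only [mul_assoc, h.r_mul_r_mul m.zero_le] using this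
  have h4 := h.ee hm one_pos
  refine h.isUnit.smul_left_cancel.1 ?_
  calc d • (e 1 * r 0 * e 1) = e 1 * r 0 * (e 1 * e 1) := by rw [h4, mul_smul_comm]
    _ = e 1 * (r 0 * e 1 * r 0 * e 1) := by
      rw [← mul_assoc, ← h3]; simp only [mul_assoc]
    _ = e 1 * e 1 * (e 0 * e 1) := by rw [h1]; simp only [mul_assoc]
    _ = d • (e 1 * e 0 * e 1) := by rw [h4, smul_mul_assoc, mul_assoc]

theorem r0_e1_e0 (hm : 1 ≤ m) : r 0 * e 1 * e 0 = e 1 * e 0 := by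
  have h1 : r 0 * (e 1 * e 0 * e 1) = e 1 * e 0 * e 1 := by
    nth_rw 1 [← h.r0e1r0e1 hm]
    rw [mul_assoc, mul_assoc, h.r_mul_r_mul m.zero_le, ← mul_assoc, h.e1_r0_e1 hm]
  refine h.isUnit.smul_left_cancel.1 ?_
  calc d • (r 0 * e 1 * e 0) = r 0 * (e 1 * e 0 * e 1) * e 0 := by
        rw [← mul_smul_comm, ← h.e0e1e0 hm]; simp only [mul_assoc]
    _ = e 1 * (e 0 * e 1 * e 0) := by rw [h1]; simp only [mul_assoc]
    _ = d • (e 1 * e 0) := by rw [h.e0e1e0 hm, mul_smul_comm]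

theorem commute_e1 (hm : 1 ≤ m) : Commute (r 0 * (r 1 * r 0 * r 1)) (e 1) := by
  have h1 : r 0 * (r 1 * r 0 * r 1) = r 1 * (r 0 * r 1 * r 0) := by
    simpa only [mul_assoc] using (h.r1010 hm).symm
  rw [Commute, SemiconjBy]
  nth_rw 2 [h1]
  rw [← mul_assoc (e 1), h.er hm, ← h.r0r1r0e1 hm]
  simp only [mul_assoc, h.re hm]

theorem e1_mul_e2 (hm : 2 ≤ m) : e 1 * e 2 = e 1 * (r 1 * r 2 * r 1) := by
  have h1 := h.rre one_pos hm
  have h2 := h.rer one_pos hm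
  have h3 : e 2 = r 1 * (r 2 * e 1 * r 2) * r 1 := by
    rw [← h2]
    simp only [mul_assoc, h.rr (i := 1) (by omega), h.r_mul_r_mul (i := 1) (by omega), mul_one]
  rw [← mul_assoc, ← mul_assoc, h.er (by omega), ← h1, h3]
  simp only [mul_assoc, h.r_mul_r_mul (i := 1) (by omega), h.r_mul_r_mul hm]

/-- The system of permutations, sign changes and idempotent-like elements attached to the
generators. -/
noncomputable def system : BrauerBSystem (Fin (m + 1)) A d where
  s := h.s
  t := h.t
  E := h.E
  F := h.F
  s_t := h.s_t
  s_E σ i j hij := by rw [← h.conj_E σ hij, conj_mul_s]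
  s_F σ i := by rw [← conj_F, conj_mul_s]
  E_symm {i j} hij := by
    have hm := one_le_of_ne hij
    have h0 := h.E_pt hm
    obtain ⟨π, rfl, rfl⟩ := exists_perm_two hij
    have hne := fun hh => hij (congrArg π hh)
    have h1 := h.conj_E (swap (pt m 0) (pt m (0 + 1))) hne
    rw [h.conj_swap_pt hm, h0, h.re hm, h.er hm, swap_apply_left, swap_apply_right] at h1
    rw [← h.conj_E _ hne, ← h.conj_E _ (Ne.symm hne), ← h1, h0]
  E_swap {i j} hij := by
    have hm := one_le_of_ne hij
    obtain ⟨π, rfl, rfl⟩ := exists_perm_two hij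
    rw [← h.conj_E _ (fun hh => hij (congrArg π hh)), ← conj_s_swap, h.E_pt hm, h.s_swap hm,
      ← map_mul, h.er hm]
  E_sq {i j} hij := by
    rw [E, ← map_mul, h.ee (one_le_of_ne hij) one_pos, map_smul]
  E_mul_E {i j k} hij hjk hik := by
    obtain ⟨hm, π, rfl, rfl, rfl⟩ := exists_perm_three hij hjk hik
    rw [← h.conj_E _ (fun hh => hij (congrArg π hh)), ← h.conj_E _ (fun hh => hjk (congrArg π hh)),
      ← conj_s_swap, h.E_pt (k := 0) (by omega), h.E_pt (k := 1) hm, h.s_swap_zero_two hm,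
      ← map_mul, ← map_mul, h.e1_mul_e2 hm]
  E_comm {i j k l} hij hkl hik hil hjk hjl := by
    obtain ⟨hm, π, rfl, rfl, rfl, rfl⟩ := exists_perm_four hij hkl hik hil hjk hjl
    rw [← h.conj_E _ (fun hh => hij (congrArg π hh)), ← h.conj_E _ (fun hh => hkl (congrArg π hh)),
      h.E_pt (k := 0) (by omega), h.E_pt (k := 2) hm]
    exact Commute.map (h.ee_far le_rfl hm) (h.conj π)
  t_comm_E {i j k} hij hki hkj := by
    obtain ⟨hm, π, rfl, rfl, rfl⟩ := exists_perm_three hki hij hkj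
    rw [t_mulSingle, ← h.conj_E _ (fun hh => hij (congrArg π hh)), ← conj_T, h.T_zero,
      h.E_pt (k := 1) hm]
    exact Commute.map (h.er_far (by omega) hm (by omega)).symm (h.conj π)
  tt_comm_E {i j} hij := by
    have hm := one_le_of_ne hij
    obtain ⟨π, rfl, rfl⟩ := exists_perm_two hij
    rw [t_mulSingle, t_mulSingle, ← h.conj_E _ (fun hh => hij (congrArg π hh)), ← conj_T, ← conj_T,
      h.T_zero, h.T_one hm, h.E_pt hm, ← map_mul]
    exact (h.commute_e1 hm).map (h.conj π)
  F_comm_E {i j k} hij hki hkj := by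
    obtain ⟨hm, π, rfl, rfl, rfl⟩ := exists_perm_three hki hij hkj
    rw [← h.conj_E _ (fun hh => hij (congrArg π hh)), ← conj_F, h.F_zero, h.E_pt (k := 1) hm]
    exact Commute.map (h.ee_far le_rfl hm) (h.conj π)
  t_F f i := by
    induction f using sign_induction with
    | one => rw [map_one, one_mul]
    | mul f g hf hg => rw [map_mul, mul_assoc, hg, hf]
    | single j => rw [t_mulSingle, T_F]
  F_t f i := by
    induction f using sign_induction with
    | one => rw [map_one, mul_one]
    | mul f g hf hg => rw [map_mul, ← mul_assoc, hf, hg]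
    | single j => rw [t_mulSingle, F_T]
  F_sq i := by rw [F, ← map_mul, h.e0e0, map_smul]
  F_E_F {i j} hij := by
    have hm := one_le_of_ne hij
    obtain ⟨π, rfl, rfl⟩ := exists_perm_two hij
    rw [← h.conj_E _ (fun hh => hij (congrArg π hh)), ← conj_F, h.F_zero, h.E_pt hm,
      ← map_mul, ← map_mul, h.e0e1e0 hm, map_smul]
  F_s_F {i j} hij := by
    have hm := one_le_of_ne hij
    obtain ⟨π, rfl, rfl⟩ := exists_perm_two hij
    rw [← conj_s_swap, ← conj_F, h.F_zero, h.s_swap hm, ← map_mul, ← map_mul, h.e0r1e0 hm, map_smul]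
  E_t_E {i j} hij := by
    have hm := one_le_of_ne hij
    obtain ⟨π, rfl, rfl⟩ := exists_perm_two hij
    rw [t_mulSingle, ← h.conj_E _ (fun hh => hij (congrArg π hh)), ← conj_F, ← conj_T, h.F_zero,
      h.T_zero, h.E_pt hm]
    simp only [← map_mul, zero_add, h.e1_r0_e1 hm]
  F_E_t {i j} hij := by
    have hm := one_le_of_ne hij
    obtain ⟨π, rfl, rfl⟩ := exists_perm_two hij
    rw [t_mulSingle, ← h.conj_E _ (fun hh => hij (congrArg π hh)), ← conj_F, ← conj_T, h.F_zero,
      h.T_zero, h.E_pt hm]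
    simp only [← map_mul, zero_add, h.e0e1r0 hm]
  t_E_F {i j} hij := by
    have hm := one_le_of_ne hij
    obtain ⟨π, rfl, rfl⟩ := exists_perm_two hij
    rw [t_mulSingle, ← h.conj_E _ (fun hh => hij (congrArg π hh)), ← conj_F, ← conj_T, h.F_zero,
      h.T_zero, h.E_pt hm]
    simp only [← map_mul, zero_add, h.r0_e1_e0 hm]

open Submodule in
theorem exists_finset_span (hgen : Algebra.adjoin R (r '' Set.Iic m ∪ e '' Set.Iic m) = ⊤) :
    ∃ T : Finset A, T.card ≤ fB (m + 1) ∧ span R (T : Set A) = ⊤ := by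
  have key : h.system.wordSpan = ⊤ := by
    rw [eq_top_iff]
    rintro a -
    have ha : a ∈ Algebra.adjoin R (r '' Set.Iic m ∪ e '' Set.Iic m) := hgen ▸ trivial
    suffices ∀ b ∈ h.system.wordSpan, a * b ∈ h.system.wordSpan by
      simpa using this 1 BrauerBSystem.one_mem_wordSpan
    induction ha using Algebra.adjoin_induction with
    | mem x hx =>
      intro b hb
      rcases hx with ⟨i, hi, rfl⟩ | ⟨i, hi, rfl⟩ <;> rw [Set.mem_Iic] at hi <;> cases i with
      | zero => ?_
      | succ i => ?_
      · rw [← h.T_zero, ← h.t_mulSingle]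
        exact BrauerBSystem.t_mul_mem_wordSpan _ hb
      · rw [← h.s_swap hi]
        exact BrauerBSystem.s_mul_mem_wordSpan _ hb
      · rw [← h.F_zero]
        exact BrauerBSystem.F_mul_mem_wordSpan _ hb
      · rw [← h.E_pt hi]
        exact BrauerBSystem.E_mul_mem_wordSpan (pt_ne (by omega) hi (by omega)) hb
    | algebraMap c =>
      intro b hb
      rw [← Algebra.smul_def]
      exact smul_mem _ _ hb
    | add x y _ _ hx hy =>
      intro b hb
      rw [add_mul]
      exact add_mem (hx b hb) (hy b hb)
    | mul x y _ _ hx hy =>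
      intro b hb
      rw [mul_assoc]
      exact hx _ (hy b hb)
  simpa using h.system.exists_finset_span key

end IsBrauerBFamily

section BrauerB

theorem rb_of_lt {n i : ℕ} (h : i < n) :
    rb n i = RingQuot.mkAlgHom Lp (BrauerBRel n) (fr ⟨i, h⟩) := dif_pos h

theorem eb_of_lt {n i : ℕ} (h : i < n) :
    eb n i = RingQuot.mkAlgHom Lp (BrauerBRel n) (fe ⟨i, h⟩) := dif_pos h

theorem isBrauerBFamily_rb_eb (m : ℕ) :
    IsBrauerBFamily m δpar (rb (m + 1)) (eb (m + 1)) := by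
  have lift {a b} (h : BrauerBRel (m + 1) a b) := RingQuot.mkAlgHom_rel Lp h
  have hr {i : ℕ} (h : i ≤ m) := rb_of_lt (Nat.lt_succ_of_le h)
  have he {i : ℕ} (h : i ≤ m) := eb_of_lt (Nat.lt_succ_of_le h)
  have h0 := m.zero_le
  refine
    { isUnit := LaurentPolynomial.isUnit_T 1
      rr := fun {i} h => ?_
      re := fun {i} h => ?_
      er := fun {i} h => ?_
      ee := fun {i} h hi => ?_
      e0e0 := ?_
      rr_far := fun {i j} h hj => ?_
      er_far := fun {i j} h hi hj => ?_
      ee_far := fun {i j} h hj => ?_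
      braid := fun {i} hi h => ?_
      rre := fun {i} hi h => ?_
      rer := fun {i} hi h => ?_
      r1010 := fun h => ?_
      r0r1e0 := fun h => ?_
      r0e1r0e1 := fun h => ?_
      r0r1r0e1 := fun h => ?_
      e0r1e0 := fun h => ?_
      e0e1e0 := fun h => ?_
      e0r1r0 := fun h => ?_
      e0e1r0 := fun h => ?_ }
  · rw [hr h, ← map_mul, lift (.rr _), map_one]
  · rw [hr h, he h, ← map_mul, lift (.re _)]
  · rw [hr h, he h, ← map_mul, lift (.er _)]
  · rw [he h, ← map_mul, lift (.ee _ hi), map_smul]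
  · rw [he h0, ← map_mul, lift (.e0e0 _ rfl), map_smul]
  · rw [hr hj, hr (by omega : i ≤ m), ← map_mul, lift (.rrFar _ _ (.inl h)), map_mul]
  · rw [he hi, hr hj, ← map_mul, lift (.erFar _ _ h), map_mul]
  · rw [he hj, he (by omega : i ≤ m), ← map_mul, lift (.eeFar _ _ (.inl h)), map_mul]
  · rw [hr h, hr (by omega : i ≤ m)]
    simpa only [map_mul] using
      lift (.braid ⟨i, by omega⟩ ⟨i + 1, by omega⟩ (.inl rfl) hi (Nat.succ_pos i))
  · rw [hr h, hr (by omega : i ≤ m), he h, he (by omega : i ≤ m)]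
    simpa only [map_mul] using
      lift (.rre ⟨i, by omega⟩ ⟨i + 1, by omega⟩ (.inl rfl) hi (Nat.succ_pos i))
  · rw [hr h, hr (by omega : i ≤ m), he h, he (by omega : i ≤ m)]
    simpa only [map_mul] using
      lift (.rer ⟨i, by omega⟩ ⟨i + 1, by omega⟩ (.inl rfl) hi (Nat.succ_pos i))
  · rw [hr h, hr h0]
    simpa only [map_mul] using lift (.b1010 ⟨0, by omega⟩ ⟨1, by omega⟩ rfl rfl)
  · rw [hr h, hr h0, he h0]
    simpa only [map_mul] using lift (.b_r0r1e0 ⟨0, by omega⟩ ⟨1, by omega⟩ rfl rfl)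
  · rw [hr h0, he h, he h0]
    simpa only [map_mul] using lift (.b_r0e1r0e1 ⟨0, by omega⟩ ⟨1, by omega⟩ rfl rfl)
  · rw [hr h, hr h0, he h]
    simpa only [map_mul] using lift (.b_r0r1r0e1 ⟨0, by omega⟩ ⟨1, by omega⟩ rfl rfl)
  · rw [hr h, he h0]
    simpa only [map_mul, map_smul] using lift (.b_e0r1e0 ⟨0, by omega⟩ ⟨1, by omega⟩ rfl rfl)
  · rw [he h, he h0]
    simpa only [map_mul, map_smul] using lift (.b_e0e1e0 ⟨0, by omega⟩ ⟨1, by omega⟩ rfl rfl)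
  · rw [hr h, hr h0, he h0]
    simpa only [map_mul] using lift (.b_e0r1r0 ⟨0, by omega⟩ ⟨1, by omega⟩ rfl rfl)
  · rw [hr h0, he h, he h0]
    simpa only [map_mul] using lift (.b_e0e1r0 ⟨0, by omega⟩ ⟨1, by omega⟩ rfl rfl)

theorem adjoin_rb_eb (m : ℕ) :
    Algebra.adjoin Lp (rb (m + 1) '' Set.Iic m ∪ eb (m + 1) '' Set.Iic m) = ⊤ := by
  rw [eq_top_iff,
    ← (AlgHom.range_eq_top _).2 (RingQuot.mkAlgHom_surjective Lp (BrauerBRel (m + 1))),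
    ← Algebra.map_top, ← FreeAlgebra.adjoin_range_ι, AlgHom.map_adjoin]
  refine Algebra.adjoin_mono ?_
  rintro _ ⟨_, ⟨i | i, rfl⟩, rfl⟩
  · exact .inl ⟨i, Nat.le_of_lt_succ i.2, rb_of_lt i.2⟩
  · exact .inr ⟨i, Nat.le_of_lt_succ i.2, eb_of_lt i.2⟩

end BrauerB

/-- `Br(B_n)` is spanned as a `ℤ[δ,δ⁻¹]`-module by a set of at most
`f(n) = 2^{n+1}·(2n-1)!! − 2^n·n! + (2n+1)!! − (n+1)!` elements. -/
theorem statement_15 (n : ℕ) (hn : 1 ≤ n) :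
    ∃ S : Finset (BrauerB n), S.card ≤ fB n ∧
      Submodule.span Lp (S : Set (BrauerB n)) = ⊤ := by
  obtain ⟨m, rfl⟩ : ∃ m, n = m + 1 := ⟨n - 1, by omega⟩
  exact (isBrauerBFamily_rb_eb m).exists_finset_span (adjoin_rb_eb m)
end

section
/- For all integers n ≥ 1 and t ≥ 1 with 2t ≤ n+1, the following identity of natural numbers holds: (C(n,2t)·D(t))²·(n−2t)! + (n·C(n−1,2t−2)·D(t−1))²·(n+1−2t)! + (n·C(n−1,2t)·D(t))²·(n−1−2t)! + 2·n·(n−1)·C(n−2,2t−2)·D(t−1)·C(n,2t)·D(t)·(n−2t)! = (C(n+1,2t)·D(t))²·(n+1−2t)!, where any term whose binomial coefficient factor vanishes is interpreted as 0 (in particular factorials of negative arguments occur only in such vanishing terms). -/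
lemma mul_choose_sub_one_eq_sub_mul_choose (k s : ℕ) :
    (k + 1 + s) * (k + s).choose (k + 1) = s * (k + 1 + s).choose (k + 1) := by
  have h := Nat.choose_mul_succ_eq (k + s) (k + 1)
  rw [show k + s + 1 = k + 1 + s by ring, Nat.add_sub_cancel_left] at h
  linarith

lemma mul_mul_choose_sub_two_eq (k s : ℕ) :
    (k + 2 + s) * (k + 1 + s) * (k + s).choose k =
      (k + 2) * (k + 1) * (k + 2 + s).choose (k + 2) := by
  have h₁ := Nat.add_one_mul_choose_eq (k + s) k
  have h₂ := Nat.add_one_mul_choose_eq (k + s + 1) (k + 1)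
  rw [show k + s + 1 + 1 = k + 2 + s by ring, show k + s + 1 = k + 1 + s by ring] at h₂
  rw [show k + s + 1 = k + 1 + s by ring] at h₁
  calc (k + 2 + s) * (k + 1 + s) * (k + s).choose k
      = (k + 2 + s) * ((k + 1 + s) * (k + s).choose k) := by ring
    _ = (k + 1) * ((k + 2 + s) * (k + 1 + s).choose (k + 1)) := by rw [h₁]; ring
    _ = (k + 2) * (k + 1) * (k + 2 + s).choose (k + 2) := by rw [h₂]; ring

lemma mul_choose_sub_one_sub_two_mul_eq (k s : ℕ) :
    (k + 2 + s) * (k + 1 + s).choose k * (s + 1) =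
      (k + 2) * (k + 1) * (k + 2 + s).choose (k + 2) := by
  have h := Nat.choose_mul_succ_eq (k + s) k
  rw [show k + s + 1 - k = s + 1 by omega, show k + s + 1 = k + 1 + s by ring] at h
  rw [← mul_mul_choose_sub_two_eq, mul_assoc, ← h]
  ring

lemma choose_add_one_mul_eq (k s : ℕ) :
    (k + s + 1).choose k * (s + 1) = (k + s + 1) * (k + s).choose k := by
  have h := Nat.choose_mul_succ_eq (k + s) k
  rw [show k + s + 1 - k = s + 1 by omega] at h
  linarith

lemma sq_mul_factorial_pred {s x c : ℕ} (h : x = s * c) :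
    x ^ 2 * (s - 1).factorial = s * c ^ 2 * s.factorial := by
  subst h
  cases s with
  | zero => simp
  | succ s => rw [Nat.add_sub_cancel, Nat.factorial_succ]; ring


/-- For all `n ≥ 1`, `t ≥ 1` with `2t ≤ n+1`:
`(C(n,2t)·D(t))²·(n−2t)! + (n·C(n−1,2t−2)·D(t−1))²·(n+1−2t)!`
`+ (n·C(n−1,2t)·D(t))²·(n−1−2t)! + 2·n·(n−1)·C(n−2,2t−2)·D(t−1)·C(n,2t)·D(t)·(n−2t)!`
`= (C(n+1,2t)·D(t))²·(n+1−2t)!` (terms with vanishing binomial factor are `0`;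
the truncated `ℕ`-subtractions inside factorials occur only in such vanishing terms). -/
theorem statement_16 (n t : ℕ) (hn : 1 ≤ n) (ht : 1 ≤ t) (htn : 2 * t ≤ n + 1) :
    (Nat.choose n (2 * t) * doubleFactOdd t) ^ 2 * Nat.factorial (n - 2 * t) +
      (n * Nat.choose (n - 1) (2 * t - 2) * doubleFactOdd (t - 1)) ^ 2 *
        Nat.factorial (n + 1 - 2 * t) +
      (n * Nat.choose (n - 1) (2 * t) * doubleFactOdd t) ^ 2 *
        Nat.factorial (n - 1 - 2 * t) +
      2 * (n * (n - 1) * Nat.choose (n - 2) (2 * t - 2) * doubleFactOdd (t - 1) *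
        (Nat.choose n (2 * t) * doubleFactOdd t)) * Nat.factorial (n - 2 * t) =
    (Nat.choose (n + 1) (2 * t) * doubleFactOdd t) ^ 2 * Nat.factorial (n + 1 - 2 * t) := by
  obtain ⟨u, rfl⟩ : ∃ u, t = u + 1 := ⟨t - 1, by omega⟩
  have hD : doubleFactOdd (u + 1) = (2 * u + 1) * doubleFactOdd u := rfl
  rw [Nat.add_sub_cancel, hD]
  generalize doubleFactOdd u = d
  obtain rfl | ⟨s, rfl⟩ : n = 2 * u + 1 ∨ ∃ s, n = 2 * u + 2 + s := by
    by_cases h : n = 2 * u + 1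
    · exact Or.inl h
    · exact Or.inr ⟨n - (2 * u + 2), by omega⟩
  · simp [mul_add, Nat.choose_eq_zero_of_lt]
  rw [show 2 * (u + 1) = 2 * u + 2 by ring,
    show 2 * u + 2 + s - (2 * u + 2) = s by omega,
    show 2 * u + 2 + s - 1 = 2 * u + 1 + s by omega,
    show 2 * u + 2 + s - 2 = 2 * u + s by omega,
    show 2 * u + 2 - 2 = 2 * u by omega,
    show 2 * u + 2 + s + 1 - (2 * u + 2) = s + 1 by omega,
    show 2 * u + 1 + s - (2 * u + 2) = s - 1 by omega, mul_mul_choose_sub_two_eq,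
    sq_mul_factorial_pred (s := s) (c := (2 * u + 2 + s).choose (2 * u + 2) * ((2 * u + 1) * d))
      (by rw [mul_choose_sub_one_eq_sub_mul_choose (2 * u + 1) s, mul_assoc]),
    Nat.factorial_succ]
  have hmid := mul_choose_sub_one_sub_two_mul_eq (2 * u) s
  have htop := choose_add_one_mul_eq (2 * u + 2) s
  generalize (2 * u + 2 + s).choose (2 * u + 2) = c at *
  generalize (2 * u + 2 + s) * (2 * u + 1 + s).choose (2 * u) = a at *
  generalize (2 * u + 2 + s + 1).choose (2 * u + 2) = b at *
  apply Nat.eq_of_mul_eq_mul_right (Nat.succ_pos s)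
  rw [Nat.succ_eq_add_one]
  generalize s.factorial = f
  zify at hmid htop ⊢
  linear_combination
    d ^ 2 * f * (a * (s + 1) + (2 * u + 2) * (2 * u + 1) * c : ℤ) * hmid -
      ((2 * u + 1) * d) ^ 2 * f * (b * (s + 1) + (2 * u + 2 + s + 1) * c : ℤ) * htop
end

section
/- In Br(B_n): (i) for n ≥ 3, e_0·e_2·e_2* = δ·e_0·e_2; (ii) for n ≥ 4, e_1·e_1*·e_3·e_3* = δ·e_1·e_1*·e_3, where e_1* = r_0e_1r_0 and e_i* = r_{i−1}r_i·e_{i−1}*·r_ir_{i−1} for i ≥ 2. -/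
/-- The elements `e_i*` of `Br(B_n)`: `e₁* = r₀e₁r₀` and
`e_i* = r_{i-1}r_i·e_{i-1}*·r_ir_{i-1}` for `i ≥ 2` (junk value `1` at `i = 0`). -/
noncomputable def es (n : ℕ) : ℕ → BrauerB n
  | 0 => 1
  | 1 => rb n 0 * eb n 1 * rb n 0
  | (i + 2) => rb n (i + 1) * rb n (i + 2) * es n (i + 1) * rb n (i + 2) * rb n (i + 1)

theorem mkAlgHom_eq {n : ℕ} {x y : FreeAlgebra Lp (BGen n)} (h : BrauerBRel n x y) :
    RingQuot.mkAlgHom Lp (BrauerBRel n) x = RingQuot.mkAlgHom Lp (BrauerBRel n) y :=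
  RingQuot.mkAlgHom_rel Lp h

theorem δpar_smul_injective {M : Type*} [AddCommMonoid M] [Module Lp M] :
    Function.Injective fun x : M => δpar • x :=
  fun _ _ h => (LaurentPolynomial.isUnit_T (R := ℤ) 1).smul_left_cancel.mp h

section Generators

variable {n i j : ℕ}

theorem rb_mul_self (hi : i < n) : rb n i * rb n i = 1 := by
  simpa [rb, hi] using mkAlgHom_eq (BrauerBRel.rr ⟨i, hi⟩)

theorem eb_mul_rb_self (hi : i < n) : eb n i * rb n i = eb n i := by
  simpa [rb, eb, hi] using mkAlgHom_eq (BrauerBRel.er ⟨i, hi⟩)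

theorem eb_mul_self (hi : i < n) (h : 0 < i) : eb n i * eb n i = δpar • eb n i := by
  simpa [eb, hi] using mkAlgHom_eq (BrauerBRel.ee ⟨i, hi⟩ h)

theorem eb_mul_eb_comm (hi : i < n) (hj : j < n) (h : i + 2 ≤ j ∨ j + 2 ≤ i) :
    eb n i * eb n j = eb n j * eb n i := by
  simpa [eb, hi, hj] using mkAlgHom_eq (BrauerBRel.eeFar ⟨i, hi⟩ ⟨j, hj⟩ h)

theorem rb_mul_rb_mul_eb (hi : i < n) (hj : j < n) (h : i + 1 = j ∨ j + 1 = i)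
    (hi0 : 0 < i) (hj0 : 0 < j) : rb n j * rb n i * eb n j = eb n i * eb n j := by
  simpa [rb, eb, hi, hj] using mkAlgHom_eq (BrauerBRel.rre ⟨i, hi⟩ ⟨j, hj⟩ h hi0 hj0)

theorem rb_mul_eb_mul_rb (hi : i < n) (hj : j < n) (h : i + 1 = j ∨ j + 1 = i)
    (hi0 : 0 < i) (hj0 : 0 < j) : rb n i * eb n j * rb n i = rb n j * eb n i * rb n j := by
  simpa [rb, eb, hi, hj] using mkAlgHom_eq (BrauerBRel.rer ⟨i, hi⟩ ⟨j, hj⟩ h hi0 hj0)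

theorem rb_zero_mul_eb_one_mul_rb_zero_mul_eb_one (hn : 1 < n) :
    rb n 0 * eb n 1 * rb n 0 * eb n 1 = eb n 1 * eb n 0 * eb n 1 := by
  have hn' : 0 < n := by omega
  simpa [rb, eb, hn, hn'] using mkAlgHom_eq (BrauerBRel.b_r0e1r0e1 ⟨0, hn'⟩ ⟨1, hn⟩ rfl rfl)

theorem eb_zero_mul_eb_one_mul_eb_zero (hn : 1 < n) :
    eb n 0 * eb n 1 * eb n 0 = δpar • eb n 0 := by
  have hn' : 0 < n := by omega
  simpa [eb, hn, hn'] using mkAlgHom_eq (BrauerBRel.b_e0e1e0 ⟨0, hn'⟩ ⟨1, hn⟩ rfl rfl)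

theorem eb_zero_mul_eb_one_mul_rb_zero (hn : 1 < n) :
    eb n 0 * eb n 1 * rb n 0 = eb n 0 * eb n 1 := by
  have hn' : 0 < n := by omega
  simpa [rb, eb, hn, hn'] using mkAlgHom_eq (BrauerBRel.b_e0e1r0 ⟨0, hn'⟩ ⟨1, hn⟩ rfl rfl)

theorem eb_mul_rb_mul_rb (hi : i < n) (hj : j < n) (h : i + 1 = j ∨ j + 1 = i)
    (hi0 : 0 < i) (hj0 : 0 < j) : eb n j * rb n i * rb n j = eb n j * eb n i := by
  calc eb n j * rb n i * rb n j
      = rb n i * (rb n i * eb n j * rb n i) * rb n j := by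
        simp only [← mul_assoc, rb_mul_self hi, one_mul]
    _ = rb n i * rb n j * eb n i := by
        rw [rb_mul_eb_mul_rb hi hj h hi0 hj0]
        simp only [mul_assoc, rb_mul_self hj, mul_one]
    _ = eb n j * eb n i := rb_mul_rb_mul_eb hj hi h.symm hj0 hi0

theorem eb_mul_eb_mul_eb (hi : i < n) (hj : j < n) (h : i + 1 = j ∨ j + 1 = i)
    (hi0 : 0 < i) (hj0 : 0 < j) : eb n j * eb n i * eb n j = eb n j := by
  have key : eb n j * eb n i * rb n j = eb n j * rb n i := by
    rw [← eb_mul_rb_mul_rb hi hj h hi0 hj0, mul_assoc, rb_mul_self hj, mul_one]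
  calc eb n j * eb n i * eb n j
      = eb n j * (rb n j * rb n i * eb n j) := by
        rw [rb_mul_rb_mul_eb hi hj h hi0 hj0, mul_assoc]
    _ = eb n j * rb n i * eb n j := by
        rw [← mul_assoc, ← mul_assoc, eb_mul_rb_self hj]
    _ = eb n j * (rb n i * eb n j * rb n i) * rb n i := by
        simp only [mul_assoc, rb_mul_self hi, mul_one]
    _ = eb n j * eb n i * rb n j * rb n i := by
        rw [rb_mul_eb_mul_rb hi hj h hi0 hj0, ← mul_assoc, ← mul_assoc, eb_mul_rb_self hj]
    _ = eb n j := by rw [key, mul_assoc, rb_mul_self hi, mul_one]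

theorem eb_one_mul_es_one (hn : 1 < n) : eb n 1 * es n 1 = eb n 1 * eb n 0 * eb n 1 := by
  have hn' : 0 < n := by omega
  have hr := rb_zero_mul_eb_one_mul_rb_zero_mul_eb_one hn
  have h : eb n 1 * es n 1 = eb n 1 * rb n 0 * eb n 1 := by
    calc eb n 1 * es n 1
        = rb n 0 * (rb n 0 * eb n 1 * rb n 0 * eb n 1) * rb n 0 := by
          simp only [es, ← mul_assoc, rb_mul_self hn', one_mul]
      _ = rb n 0 * (eb n 1 * (eb n 0 * eb n 1 * rb n 0)) := by
          rw [hr]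
          simp only [mul_assoc]
      _ = rb n 0 * (rb n 0 * eb n 1 * rb n 0 * eb n 1) := by
          rw [eb_zero_mul_eb_one_mul_rb_zero hn, hr, mul_assoc (eb n 1)]
      _ = eb n 1 * rb n 0 * eb n 1 := by
          simp only [← mul_assoc, rb_mul_self hn', one_mul]
  rw [h]
  refine δpar_smul_injective ?_
  calc δpar • (eb n 1 * rb n 0 * eb n 1)
      = eb n 1 * rb n 0 * eb n 1 * eb n 1 := by
        rw [mul_assoc _ (eb n 1), eb_mul_self hn one_pos, mul_smul_comm]
    _ = eb n 1 * (rb n 0 * eb n 1 * rb n 0 * eb n 1) := by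
        rw [← h, es, mul_assoc (eb n 1)]
    _ = δpar • (eb n 1 * eb n 0 * eb n 1) := by
        rw [hr, ← mul_assoc, ← mul_assoc, eb_mul_self hn one_pos, smul_mul_assoc, smul_mul_assoc]

theorem eb_mul_es_succ (hi : i + 2 < n) {x : BrauerB n}
    (hx : eb n (i + 1) * es n (i + 1) = x * eb n (i + 1)) :
    eb n (i + 2) * es n (i + 2) = eb n (i + 2) * x * eb n (i + 1) * eb n (i + 2) := by
  have hi' : i + 1 < n := by omega
  calc eb n (i + 2) * es n (i + 2)
      = eb n (i + 2) * rb n (i + 1) * rb n (i + 2) * es n (i + 1) * rb n (i + 2)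
          * rb n (i + 1) := by
        simp only [es, mul_assoc]
    _ = eb n (i + 2) * (eb n (i + 1) * es n (i + 1)) * rb n (i + 2) * rb n (i + 1) := by
        rw [eb_mul_rb_mul_rb hi' hi (by omega) (by omega) (by omega), mul_assoc (eb n (i + 2))]
    _ = eb n (i + 2) * x * (eb n (i + 1) * rb n (i + 2) * rb n (i + 1)) := by
        rw [hx]
        simp only [mul_assoc]
    _ = eb n (i + 2) * x * eb n (i + 1) * eb n (i + 2) := by
        rw [eb_mul_rb_mul_rb hi hi' (by omega) (by omega) (by omega), ← mul_assoc]

theorem eb_two_mul_es_two (hn : 2 < n) :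
    eb n 2 * es n 2 = eb n 2 * (eb n 1 * eb n 0) * eb n 1 * eb n 2 :=
  eb_mul_es_succ hn (eb_one_mul_es_one (by omega))

theorem eb_three_mul_es_three (hn : 3 < n) :
    eb n 3 * es n 3 =
      eb n 3 * (eb n 2 * (eb n 1 * eb n 0) * eb n 1) * eb n 2 * eb n 3 :=
  eb_mul_es_succ hn (eb_two_mul_es_two (by omega))

end Generators

/-- In `Br(B_n)`: (i) for `n ≥ 3`, `e₀·e₂·e₂* = δ·e₀·e₂`;
(ii) for `n ≥ 4`, `e₁·e₁*·e₃·e₃* = δ·e₁·e₁*·e₃`. -/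
theorem statement_18 (n : ℕ) :
    (3 ≤ n → eb n 0 * eb n 2 * es n 2 = δpar • (eb n 0 * eb n 2)) ∧
    (4 ≤ n → eb n 1 * es n 1 * eb n 3 * es n 3 = δpar • (eb n 1 * es n 1 * eb n 3)) := by
  refine ⟨fun hn => ?_, fun hn => ?_⟩
  · have c02 := eb_mul_eb_comm (n := n) (i := 0) (j := 2) (by omega) (by omega) (by omega)
    calc eb n 0 * eb n 2 * es n 2
        = eb n 0 * eb n 2 * (eb n 1 * eb n 0) * eb n 1 * eb n 2 := by
          rw [mul_assoc, eb_two_mul_es_two (by omega)]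
          simp only [mul_assoc]
      _ = eb n 2 * (eb n 0 * eb n 1 * eb n 0) * eb n 1 * eb n 2 := by
          rw [c02]
          simp only [mul_assoc]
      _ = δpar • (eb n 0 * (eb n 2 * eb n 1 * eb n 2)) := by
          rw [eb_zero_mul_eb_one_mul_eb_zero (by omega), mul_smul_comm, ← c02]
          simp only [smul_mul_assoc, mul_assoc]
      _ = δpar • (eb n 0 * eb n 2) := by
          rw [eb_mul_eb_mul_eb] <;> omega
  · have c13 := eb_mul_eb_comm (n := n) (i := 1) (j := 3) (by omega) (by omega) (by omega)
    have e1 := eb_one_mul_es_one (n := n) (by omega)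
    calc eb n 1 * es n 1 * eb n 3 * es n 3
        = eb n 1 * eb n 0 * (eb n 1 * eb n 3) * eb n 2 * eb n 1 * eb n 0 * eb n 1 * eb n 2
            * eb n 3 := by
          rw [mul_assoc, eb_three_mul_es_three (by omega), e1]
          simp only [mul_assoc]
      _ = eb n 1 * (eb n 0 * eb n 3) * (eb n 1 * eb n 2 * eb n 1) * eb n 0 * eb n 1 * eb n 2
            * eb n 3 := by
          rw [c13]
          simp only [mul_assoc]
      _ = eb n 1 * eb n 3 * (eb n 0 * eb n 1 * eb n 0) * eb n 1 * eb n 2 * eb n 3 := by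
          rw [eb_mul_eb_mul_eb (i := 2) (j := 1) (by omega)
              (by omega) (by omega) (by omega) (by omega),
            eb_mul_eb_comm (i := 0) (j := 3) (by omega) (by omega) (by omega)]
          simp only [mul_assoc]
      _ = δpar • (eb n 1 * (eb n 3 * eb n 0) * eb n 1 * eb n 2 * eb n 3) := by
          rw [eb_zero_mul_eb_one_mul_eb_zero (by omega)]
          simp only [mul_smul_comm, smul_mul_assoc, mul_assoc]
      _ = δpar • (eb n 1 * eb n 0 * (eb n 3 * eb n 1) * eb n 2 * eb n 3) := by
          rw [eb_mul_eb_comm (i := 3) (j := 0) (by omega) (by omega) (by omega)]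
          simp only [mul_assoc]
      _ = δpar • (eb n 1 * eb n 0 * eb n 1 * (eb n 3 * eb n 2 * eb n 3)) := by
          rw [← c13]
          simp only [mul_assoc]
      _ = δpar • (eb n 1 * es n 1 * eb n 3) := by
          rw [eb_mul_eb_mul_eb (i := 2) (j := 3) (by omega)
              (by omega) (by omega) (by omega) (by omega),
            e1]
end
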